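/- arXiv:2102.04909 — 3 statements merged into one kernel-verified Lean document; each statement's English description precedes it below -/
import Mathlib

section
/- For every allocation instance with n agents and additive valuations, there exists a randomized allocation supported on at most n allocations that is ex-ante proportional, and such that every allocation A in its support satisfies, for every agent i: (a) v_i(A_i) ≥ (1/2)·TPS_i (and hence v_i(A_i) ≥ (1/2)·MMS_i), and (b) A is Prop1. -/
open Finset

/-- The value of a bundle `S` under an additive valuation with item values `v`. -/
def val {ι : Type*} (v : ι → ℝ) (S : Finset ι) : ℝ := ∑ j ∈ S, v j

/-- `A` is an allocation: the bundles are pairwise disjoint and cover all items. -/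
def isAlloc {ι : Type*} [Fintype ι] [DecidableEq ι] {n : ℕ} (A : Fin n → Finset ι) : Prop :=
  (∀ i j : Fin n, i ≠ j → Disjoint (A i) (A j)) ∧ Finset.univ.biUnion A = Finset.univ

/-- `t` is the truncated proportional share `TPS(k, S, v)`: the largest `t ≥ 0`
with `(1/k) · Σ_{j ∈ S} min(v j, t) = t`. -/
def isTPS {ι : Type*} (k : ℕ) (S : Finset ι) (v : ι → ℝ) (t : ℝ) : Prop :=
  IsGreatest {t' : ℝ | 0 ≤ t' ∧ (∑ j ∈ S, min (v j) t') / k = t'} t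

/-- `μ` is the maximin share of an agent with valuation `v` among `n` agents:
the maximum over partitions into `n` bundles of the minimum bundle value. -/
def isMMS {ι : Type*} [Fintype ι] [DecidableEq ι] (n : ℕ) (v : ι → ℝ) (μ : ℝ) : Prop :=
  IsGreatest {x : ℝ | ∃ P : Fin n → Finset ι, isAlloc P ∧ x = ⨅ i : Fin n, val v (P i)} μ

/-- An allocation is Prop1 if every agent either attains her proportional share,
or does so after adding one item not in her bundle. -/
def isProp1 {ι : Type*} [Fintype ι] {n : ℕ} (v : Fin n → ι → ℝ)
    (A : Fin n → Finset ι) : Prop :=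
  ∀ i : Fin n, val (v i) (A i) ≥ val (v i) Finset.univ / n ∨
    ∃ j, j ∉ A i ∧ val (v i) (A i) + v i j ≥ val (v i) Finset.univ / n


theorem Finset.exists_initial_segment {κ : Type*} [LinearOrder κ] (M : Finset κ) (n : ℕ)
    (hn : n ≤ #M) : ∃ G ⊆ M, #G = n ∧ ∀ x ∈ G, ∀ y ∈ M \ G, x < y := by
  induction n with
  | zero => exact ⟨∅, by simp⟩
  | succ n ih =>
    obtain ⟨G, hG, hc, hlt⟩ := ih (by omega)
    have hne : (M \ G).Nonempty := by
      rw [← card_pos, card_sdiff_of_subset hG]; omega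
    have hmin := (M \ G).min'_mem hne
    obtain ⟨hmM, hmG⟩ := mem_sdiff.1 hmin
    refine ⟨insert ((M \ G).min' hne) G, insert_subset hmM hG, by
      rw [card_insert_of_notMem hmG, hc], fun x hx y hy => ?_⟩
    obtain ⟨hyM, hy⟩ := mem_sdiff.1 hy
    obtain ⟨hne', hyG⟩ : y ≠ _ ∧ y ∉ G := by simpa using hy
    rcases mem_insert.1 hx with rfl | hx
    · exact lt_of_le_of_ne ((M \ G).min'_le y (mem_sdiff.2 ⟨hyM, hyG⟩)) (Ne.symm hne')
    · exact hlt x hx y (mem_sdiff.2 ⟨hyM, hyG⟩)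

/-- Taking every `n`-th item of `M` in increasing order. -/
theorem exists_every_nth {κ : Type*} [LinearOrder κ] (n : ℕ) (hn : 2 ≤ n) (M : Finset κ) :
    ∃ B ⊆ M, ∃ F ⊆ M, #F ≤ n - 1 ∧ (∀ x ∈ B, ∃ y ∈ M, y < x) ∧
      ∀ f : κ → ℝ, Antitone f → (∀ x, 0 ≤ f x) →
        n * val f B ≤ val f M ∧ val f M ≤ n * val f B + val f F := by
  induction hc : #M using Nat.strong_induction_on generalizing M with
  | _ c ih =>
  by_cases h : #M < n
  · exact ⟨∅, by simp, M, subset_rfl, by omega, by simp, fun f _ hf =>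
      ⟨by simpa [_root_.val] using sum_nonneg fun x _ => hf x, by simp [_root_.val]⟩⟩
  obtain ⟨G, hG, hGc, hlt⟩ := M.exists_initial_segment n (by omega)
  have hGne : G.Nonempty := card_pos.1 (by omega)
  set g := G.max' hGne with hg
  have hgG : g ∈ G := G.max'_mem hGne
  obtain ⟨B, hB, F, hF, hFc, -, hBF⟩ := ih #(M \ G)
    (by rw [card_sdiff_of_subset hG]; omega) (M \ G) rfl
  have hgB : g ∉ B := fun h => (mem_sdiff.1 (hB h)).2 hgG
  obtain ⟨y, hy⟩ : (G.erase g).Nonempty := by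
    rw [← card_pos, card_erase_of_mem hgG]; omega
  have hyg : y < g := lt_of_le_of_ne (G.le_max' y (mem_of_mem_erase hy)) (ne_of_mem_erase hy)
  refine ⟨insert g B, insert_subset (hG hgG) (hB.trans sdiff_subset), G.erase g,
    (erase_subset _ _).trans hG, by rw [card_erase_of_mem hgG, hGc], fun x hx => ?_,
    fun f hf hf0 => ?_⟩
  · refine ⟨y, hG (mem_of_mem_erase hy), ?_⟩
    rcases mem_insert.1 hx with rfl | hx
    · exact hyg
    · exact hyg.trans (hlt g hgG x (hB hx))
  obtain ⟨h1, h2⟩ := hBF f hf hf0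
  have hsplit : val f M = val f (M \ G) + val f G := (sum_sdiff hG).symm
  have hins : val f (insert g B) = f g + val f B := sum_insert hgB
  have hera : val f G = f g + val f (G.erase g) := (add_sum_erase G f hgG).symm
  have hGle : n * f g ≤ val f G := by
    have := G.card_nsmul_le_sum f (f g) fun x hx => hf (G.le_max' x hx)
    rwa [hGc, nsmul_eq_mul] at this
  have hFle : val f F ≤ (n - 1) * f g := by
    have := F.sum_le_card_nsmul f (f g) fun x hx => hf (hlt g hgG x (hF hx)).le
    rw [nsmul_eq_mul] at this
    refine this.trans (mul_le_mul_of_nonneg_right ?_ (hf0 g))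
    have : ((#F : ℕ) : ℝ) + 1 ≤ n := by exact_mod_cast (by omega : #F + 1 ≤ n)
    linarith
  rw [hsplit, hins]
  constructor
  · linarith
  · linarith

theorem exists_minimal_loss {α : Type*} (N : Finset α) (w P b : α → ℝ) (c : ℝ)
    (hw : ∀ i, 0 ≤ w i) (i₀ : α) (hi₀ : i₀ ∈ N) (hb : c * P i₀ ≤ b i₀)
    (hmin : ∀ i ∈ N, (1 - c) * (w i₀ * P i₀) ≤ (1 - c) * (w i * P i)) :
    ∃ k ∈ N, c * P k ≤ b k ∧ ∀ i ∈ N, w k * (P k - b k) ≤ w i * (P i - b i) := by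
  obtain ⟨k, hk, hkmin⟩ := N.exists_min_image (fun i => w i * (P i - b i)) ⟨i₀, hi₀⟩
  rcases (hkmin i₀ hi₀).lt_or_eq with hlt | heq
  · refine ⟨k, hk, ?_, hkmin⟩
    by_contra! hcon
    have h1 := mul_le_mul_of_nonneg_left hb (hw i₀)
    have h2 := mul_le_mul_of_nonneg_left hcon.le (hw k)
    have h3 := hmin k hk
    nlinarith
  · exact ⟨i₀, hi₀, hb, fun i hi => heq ▸ hkmin i hi⟩

theorem exists_reducing_bundle {α κ : Type*} [LinearOrder κ] (N : Finset α)
    (hN : 2 ≤ #N) (M : Finset κ) (v : α → κ → ℝ) (hv : ∀ i j, 0 ≤ v i j)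
    (hanti : ∀ i, Antitone (v i)) (w : α → ℝ) (hw : ∀ i, 0 ≤ w i) (T P : α → ℝ)
    (hT0 : ∀ i, 0 ≤ T i) (hT : ∀ i ∈ N, #N * T i ≤ ∑ j ∈ M, min (v i j) (T i))
    (hP : ∀ i, #N * P i = val (v i) M) :
    ∃ k ∈ N, ∃ B ⊆ M,
      (∀ i ∈ N, (#N - 1) * T i ≤ ∑ j ∈ M \ B, min (v i j) (T i)) ∧
      (∀ i ∈ N, val (v i) B ≤ P i ∨ ∃ j ∈ B, P i ≤ v i j) ∧
      T k / 2 ≤ val (v k) B ∧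
      (P k ≤ val (v k) B ∨ ∃ j ∈ M \ B, P k ≤ val (v k) B + v k j) ∧
      ∀ i ∈ N, w k * (P k - val (v k) B) ≤ w i * (P i - val (v i) B) := by
  have hn0 : (2 : ℝ) ≤ #N := by exact_mod_cast hN
  have hTP : ∀ i ∈ N, T i ≤ P i := fun i hi => by
    have h1 : ∑ j ∈ M, min (v i j) (T i) ≤ val (v i) M := sum_le_sum fun j _ => min_le_left _ _
    have h2 := hT i hi
    rw [← hP i] at h1
    exact le_of_mul_le_mul_left (h2.trans h1) (by linarith)
  by_cases hbig : ∃ i ∈ N, ∃ j ∈ M, P i ≤ v i j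
  · obtain ⟨i, hi, j, hj, hij⟩ := hbig
    obtain ⟨k, hk, hkb, hkm⟩ := exists_minimal_loss N w P (fun i => v i j) 1 hw i hi
      (by simpa using hij) (by simp)
    rw [one_mul] at hkb
    refine ⟨k, hk, {j}, by simpa using hj, fun i hi => ?_, fun i _ => ?_, ?_, ?_, ?_⟩
    · have h1 := sum_sdiff (f := fun j => min (v i j) (T i)) (singleton_subset_iff.2 hj)
      have h2 := hT i hi
      simp only [sum_singleton] at h1
      have h3 := min_le_right (v i j) (T i)
      linarith
    · simpa [_root_.val] using le_total (v i j) (P i)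
    · have := hTP k hk
      have := hT0 k
      simp only [_root_.val, sum_singleton]
      linarith
    · simp [_root_.val, hkb]
    · simpa [_root_.val] using hkm
  push Not at hbig
  have hTB : ∀ B ⊆ M, ∀ i ∈ N, val (v i) B ≤ P i →
      (#N - 1) * T i ≤ ∑ j ∈ M \ B, min (v i j) (T i) := by
    intro B hB i hi hBi
    rcases (hT0 i).eq_or_lt with h0 | h0
    · rw [← h0, mul_zero]
      exact sum_nonneg fun j _ => le_min (hv i j) le_rfl
    have hPi : 0 < P i := h0.trans_le (hTP i hi)
    have h1 : T i / P i * val (v i) (M \ B) ≤ ∑ j ∈ M \ B, min (v i j) (T i) := by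
      rw [_root_.val, mul_sum]
      refine sum_le_sum fun j hj => le_min ?_ ?_
      · exact mul_le_of_le_one_left (hv i j) ((div_le_one hPi).2 (hTP i hi))
      · rw [div_mul_eq_mul_div, div_le_iff₀ hPi]
        exact mul_le_mul_of_nonneg_left (hbig i hi j (sdiff_subset hj)).le h0.le
    have h2 : val (v i) (M \ B) + val (v i) B = val (v i) M := sum_sdiff hB
    have h3 : (#N - 1) * P i ≤ val (v i) (M \ B) := by
      have := hP i
      linarith
    calc (#N - 1) * T i = T i / P i * ((#N - 1) * P i) := by field_simp
      _ ≤ _ := mul_le_mul_of_nonneg_left h3 (by positivity)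
      _ ≤ _ := h1
  obtain ⟨i₀, hi₀, hmin⟩ := N.exists_min_image (fun i => w i * P i) (card_pos.1 (by omega))
  have hmin' : ∀ i ∈ N, (1 - 1 / 2 : ℝ) * (w i₀ * P i₀) ≤ (1 - 1 / 2) * (w i * P i) :=
    fun i hi => mul_le_mul_of_nonneg_left (hmin i hi) (by norm_num)
  by_cases htwo : ∃ x ∈ M, ∃ y ∈ M, x < y ∧ P i₀ / 2 ≤ v i₀ y
  · obtain ⟨x, hx, y, hy, hxy, hval⟩ := htwo
    obtain ⟨k, hk, hkb, hkm⟩ := exists_minimal_loss N w P (fun i => v i y) (1 / 2) hw i₀ hi₀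
      (by linarith) hmin'
    have hle : ∀ i ∈ N, val (v i) {y} ≤ P i := fun i hi => by
      simpa [_root_.val] using (hbig i hi y hy).le
    refine ⟨k, hk, {y}, by simpa using hy, fun i hi => hTB _ (by simpa using hy) i hi (hle i hi),
      fun i hi => .inl (hle i hi), ?_, .inr ⟨x, by simp [hx, hxy.ne], ?_⟩,
      by simpa [_root_.val] using hkm⟩
    · have := hTP k hk
      simp only [_root_.val, sum_singleton]
      linarith
    · have := hanti k hxy.le
      simp only [_root_.val, sum_singleton]
      linarith
  push Not at htwo
  obtain ⟨B, hB, F, hF, hFc, hBlt, hBF⟩ := exists_every_nth #N hN M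
  have hFc' : (#F : ℝ) ≤ #N - 1 := by
    have : ((#F : ℕ) : ℝ) + 1 ≤ #N := by exact_mod_cast (by omega : #F + 1 ≤ #N)
    linarith
  have hle : ∀ i ∈ N, val (v i) B ≤ P i := fun i _ => by
    have := (hBF (v i) (hanti i) (hv i)).1
    rw [← hP i] at this
    exact le_of_mul_le_mul_left this (by linarith)
  have hP0 : ∀ i, 0 ≤ P i := fun i => by
    have : 0 ≤ val (v i) M := sum_nonneg fun j _ => hv i j
    rw [← hP i] at this
    exact nonneg_of_mul_nonneg_right this (by linarith)
  have hhalf : 1 / 2 * P i₀ ≤ val (v i₀) B := by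
    have hFv : val (v i₀) F ≤ #N * (P i₀ / 2) := by
      rcases F.eq_empty_or_nonempty with rfl | hFne
      · have := hP0 i₀
        simp only [_root_.val, sum_empty]
        positivity
      set x := F.min' hFne
      have hxF : x ∈ F := F.min'_mem hFne
      have h1 : val (v i₀) F = v i₀ x + val (v i₀) (F.erase x) := (add_sum_erase F _ hxF).symm
      have h2 : val (v i₀) (F.erase x) ≤ #(F.erase x) • (P i₀ / 2) :=
        sum_le_card_nsmul _ _ _ fun y hy => (htwo x (hF hxF) y (hF (mem_of_mem_erase hy))
          (lt_of_le_of_ne (F.min'_le y (mem_of_mem_erase hy)) (ne_of_mem_erase hy).symm)).le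
      have h3 : ((#(F.erase x) : ℕ) : ℝ) + 1 = #F := by
        exact_mod_cast card_erase_add_one hxF
      have h4 := hbig i₀ hi₀ x (hF hxF)
      rw [nsmul_eq_mul] at h2
      have h5 : (#(F.erase x) : ℝ) * (P i₀ / 2) ≤ (#N - 2) * (P i₀ / 2) :=
        mul_le_mul_of_nonneg_right (by linarith) (by linarith [hP0 i₀])
      linarith
    have h2 := (hBF (v i₀) (hanti i₀) (hv i₀)).2
    rw [← hP i₀] at h2
    refine le_of_mul_le_mul_left (a := (#N : ℝ)) ?_ (by linarith)
    linarith
  obtain ⟨k, hk, hkb, hkm⟩ := exists_minimal_loss N w P (fun i => val (v i) B) (1 / 2) hw i₀ hi₀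
    hhalf hmin'
  refine ⟨k, hk, B, hB, fun i hi => hTB B hB i hi (hle i hi), fun i hi => .inl (hle i hi),
    by linarith [hTP k hk], ?_, hkm⟩
  rcases M.eq_empty_or_nonempty with rfl | hM
  · left
    have h1 := hP k
    have h2 : val (v k) ∅ = 0 := sum_empty
    rw [subset_empty.1 hB, h2]
    rw [h2] at h1
    nlinarith
  right
  refine ⟨M.min' hM, mem_sdiff.2 ⟨M.min'_mem hM, fun h => ?_⟩, ?_⟩
  · obtain ⟨y, hy, hlt⟩ := hBlt _ h
    exact absurd (M.min'_le y hy) (not_le.2 hlt)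
  · have h1 := (hBF (v k) (hanti k) (hv k)).2
    have h2 : val (v k) F ≤ #F • v k (M.min' hM) :=
      sum_le_card_nsmul _ _ _ fun y hy => hanti k (M.min'_le y (hF hy))
    rw [nsmul_eq_mul] at h2
    have h3 : (#F : ℝ) * v k (M.min' hM) ≤ #N * v k (M.min' hM) :=
      mul_le_mul_of_nonneg_right (by linarith) (hv k _)
    rw [← hP k] at h1
    refine le_of_mul_le_mul_left (a := (#N : ℝ)) ?_ (by linarith)
    linarith

theorem exists_fair_assignment {α κ : Type*} [DecidableEq α] [LinearOrder κ] (v : α → κ → ℝ)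
    (hv : ∀ i j, 0 ≤ v i j) (hanti : ∀ i, Antitone (v i)) (w : α → ℝ) (hw : ∀ i, 0 ≤ w i)
    (T : α → ℝ) (hT0 : ∀ i, 0 ≤ T i) (N : Finset α) (hN : N.Nonempty) (M : Finset κ)
    (hT : ∀ i ∈ N, #N * T i ≤ ∑ j ∈ M, min (v i j) (T i)) :
    ∃ a : κ → α, (∀ j ∈ M, a j ∈ N) ∧
      (∀ i ∈ N, T i / 2 ≤ val (v i) {j ∈ M | a j = i} ∧
        (val (v i) M / #N ≤ val (v i) {j ∈ M | a j = i} ∨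
          ∃ j ∈ M, a j ≠ i ∧ val (v i) M / #N ≤ val (v i) {j ∈ M | a j = i} + v i j)) ∧
      ∑ i ∈ N, w i * (val (v i) M / #N) ≤ ∑ i ∈ N, w i * val (v i) {j ∈ M | a j = i} := by
  induction hc : #N using Nat.strong_induction_on generalizing N M with
  | _ c ih =>
  subst hc
  by_cases hN1 : #N = 1
  · obtain ⟨k, rfl⟩ := card_eq_one.1 hN1
    refine ⟨fun _ => k, by simp, fun i hi => ?_, by simp⟩
    obtain rfl := mem_singleton.1 hi
    have h1 := hT i hi
    have h2 : ∑ j ∈ M, min (v i j) (T i) ≤ val (v i) M := sum_le_sum fun j _ => min_le_left _ _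
    have h3 := hT0 i
    simp only [card_singleton, Nat.cast_one, one_mul] at h1
    exact ⟨by simp only [filter_true]; linarith, .inl (by simp)⟩
  have hN2 : 2 ≤ #N := by have := hN.card_pos; omega
  have hn0 : (2 : ℝ) ≤ #N := by exact_mod_cast hN2
  set P : α → ℝ := fun i => val (v i) M / #N with hPdef
  have hP : ∀ i, #N * P i = val (v i) M := fun i => by
    simp only [hPdef]; field_simp
  obtain ⟨k, hk, B, hB, hTB, hPB, hkT, hkP, hmin⟩ :=
    exists_reducing_bundle N hN2 M v hv hanti w hw T P hT0 hT hP
  have hcard : ((#(N.erase k) : ℕ) : ℝ) = #N - 1 := by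
    rw [card_erase_of_mem hk, Nat.cast_sub (by omega), Nat.cast_one]
  obtain ⟨a, haN, hafair, hasum⟩ := ih #(N.erase k) (card_erase_lt_of_mem hk) (N.erase k)
    (by rw [← card_pos, card_erase_of_mem hk]; omega) (M \ B)
    (fun i hi => by rw [hcard]; exact hTB i (mem_of_mem_erase hi)) rfl
  rw [hcard] at hafair hasum
  have hfk : {j ∈ M | (if j ∈ B then k else a j) = k} = B := by
    ext j
    simp only [mem_filter]
    constructor
    · rintro ⟨hjM, hj⟩
      by_contra hjB
      rw [if_neg hjB] at hj
      exact ne_of_mem_erase (haN j (mem_sdiff.2 ⟨hjM, hjB⟩)) hj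
    · exact fun hj => ⟨hB hj, if_pos hj⟩
  have hfi : ∀ i, i ≠ k → {j ∈ M | (if j ∈ B then k else a j) = i} = {j ∈ M \ B | a j = i} := by
    intro i hi
    ext j
    by_cases hj : j ∈ B <;> simp [hj, hi.symm]
  have hVB : ∀ i, val (v i) (M \ B) = #N * P i - val (v i) B := fun i => by
    have : val (v i) (M \ B) + val (v i) B = val (v i) M := sum_sdiff hB
    rw [hP]; linarith
  refine ⟨fun j => if j ∈ B then k else a j, fun j hj => ?_, fun i hi => ?_, ?_⟩
  · by_cases hjB : j ∈ B
    · simpa [hjB] using hk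
    · simpa [hjB] using mem_of_mem_erase (haN j (mem_sdiff.2 ⟨hj, hjB⟩))
  · by_cases hik : i = k
    · subst hik
      simp only [hfk]
      refine ⟨hkT, hkP.imp id ?_⟩
      rintro ⟨j, hj, hjP⟩
      obtain ⟨hjM, hjB⟩ := mem_sdiff.1 hj
      refine ⟨j, hjM, ?_, hjP⟩
      simpa [hjB] using ne_of_mem_erase (haN j hj)
    · simp only [hfi i hik]
      obtain ⟨h1, h2⟩ := hafair i (mem_erase.2 ⟨hik, hi⟩)
      refine ⟨h1, ?_⟩
      rcases hPB i hi with hle | ⟨j, hj, hPj⟩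
      · have hPle : P i ≤ val (v i) (M \ B) / (#N - 1) := by
          rw [le_div_iff₀ (by linarith), hVB]
          linarith
        refine h2.imp hPle.trans ?_
        rintro ⟨j, hj, haj, hjP⟩
        obtain ⟨hjM, hjB⟩ := mem_sdiff.1 hj
        exact ⟨j, hjM, by simpa [hjB] using haj, hPle.trans hjP⟩
      · refine .inr ⟨j, hB hj, by simpa [hj] using Ne.symm hik, ?_⟩
        have : 0 ≤ val (v i) {j ∈ M \ B | a j = i} := sum_nonneg fun j _ => hv i j
        linarith
  · rw [← add_sum_erase N _ hk, ← add_sum_erase N _ hk]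
    simp only [hfk]
    have h1 : ∑ i ∈ N.erase k, w i * val (v i) {j ∈ M | (if j ∈ B then k else a j) = i} =
        ∑ i ∈ N.erase k, w i * val (v i) {j ∈ M \ B | a j = i} :=
      sum_congr rfl fun i hi => by rw [hfi i (ne_of_mem_erase hi)]
    rw [h1]
    have h2 : ∑ i ∈ N.erase k, w i * (val (v i) (M \ B) / (#N - 1)) =
        ∑ i ∈ N.erase k, w i * P i +
          (∑ i ∈ N.erase k, w i * (P i - val (v i) B)) / (#N - 1) := by
      rw [sum_div, ← sum_add_distrib]
      refine sum_congr rfl fun i _ => ?_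
      rw [hVB]
      have : (#N : ℝ) - 1 ≠ 0 := by linarith
      field_simp
      ring
    have h3 : w k * (P k - val (v k) B) ≤
        (∑ i ∈ N.erase k, w i * (P i - val (v i) B)) / (#N - 1) := by
      rw [le_div_iff₀ (by linarith), mul_comm, ← hcard, ← nsmul_eq_mul]
      exact card_nsmul_le_sum _ _ _ fun i hi => hmin i (mem_of_mem_erase hi)
    change w k * P k + ∑ i ∈ N.erase k, w i * P i ≤ _
    linarith

/-- A picking sequence: the agent `o r` moving in round `r` obtains an item at least as good as the
`r`-th item of her own ranking. -/
theorem exists_picking_sequence {ι α : Type*} [Fintype ι] [DecidableEq ι]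
    (σ : α → Fin (Fintype.card ι) ≃ ι) (o : Fin (Fintype.card ι) → α) :
    ∃ π : Fin (Fintype.card ι) ≃ ι, ∀ r, (σ (o r)).symm (π r) ≤ r := by
  obtain ⟨f, hf, hft⟩ := (all_card_le_biUnion_card_iff_exists_injective
    fun r => (Iic r).map (σ (o r)).toEmbedding).1 fun S => by
      rcases S.eq_empty_or_nonempty with rfl | hS
      · simp
      calc #S ≤ #(Iic (S.max' hS)) := card_le_card fun r hr => mem_Iic.2 (S.le_max' r hr)
        _ = #((Iic (S.max' hS)).map (σ (o (S.max' hS))).toEmbedding) := (card_map _).symm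
        _ ≤ _ := card_le_card
          (subset_biUnion_of_mem (fun r => (Iic r).map (σ (o r)).toEmbedding) (S.max'_mem hS))
  refine ⟨Equiv.ofBijective f ((Fintype.bijective_iff_injective_and_card f).2 ⟨hf, by simp⟩),
    fun r => ?_⟩
  obtain ⟨s, hs, hsr⟩ := mem_map.1 (hft r)
  simpa [← hsr] using hs

theorem val_le_val_map {κ ι : Type*} (v : ι → ℝ) (σ π : κ ≃ ι) (R : Finset κ)
    (h : ∀ r ∈ R, v (σ r) ≤ v (π r)) : val (v ∘ σ) R ≤ val v (R.map π.toEmbedding) := by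
  simpa [_root_.val] using sum_le_sum h

theorem exists_add_le_val_map {κ ι : Type*} [Fintype κ] [Fintype ι] [DecidableEq κ] (v : ι → ℝ)
    (σ π : κ ≃ ι) (R : Finset κ) (h : ∀ r ∈ R, v (σ r) ≤ v (π r)) (s : κ) (hs : s ∉ R) :
    R.map π.toEmbedding = univ ∨ ∃ j, j ∉ R.map π.toEmbedding ∧
      val (v ∘ σ) R + v (σ s) ≤ val v (R.map π.toEmbedding) + v j := by
  classical
  set Q := R.map π.toEmbedding with hQ
  by_cases hne : (Qᶜ : Finset ι).Nonempty
  swap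
  · left
    rwa [not_nonempty_iff_eq_empty, compl_eq_empty_iff] at hne
  right
  obtain ⟨j, hj, hjmax⟩ := exists_max_image Qᶜ v hne
  refine ⟨j, mem_compl.1 hj, ?_⟩
  set c := v j
  have hsplit : ∀ x : ℝ, x = c + max (x - c) 0 - max (c - x) 0 := fun x => by
    rcases le_total x c with h | h
    · rw [max_eq_right (by linarith), max_eq_left (by linarith)]; ring
    · rw [max_eq_left (by linarith), max_eq_right (by linarith)]; ring
  have hpos : ∑ r ∈ insert s R, max (v (σ r) - c) 0 ≤ ∑ q ∈ Q, max (v q - c) 0 := calc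
    _ ≤ ∑ r, max (v (σ r) - c) 0 :=
      sum_le_sum_of_subset_of_nonneg (subset_univ _) fun _ _ _ => le_max_right _ _
    _ = ∑ q, max (v q - c) 0 := σ.sum_comp fun q => max (v q - c) 0
    _ = ∑ q ∈ Q, max (v q - c) 0 := (sum_subset (subset_univ _) fun q _ hq =>
      max_eq_right (by linarith [hjmax q (mem_compl.2 hq)])).symm
  have hneg : ∑ q ∈ Q, max (c - v q) 0 ≤ ∑ r ∈ R, max (c - v (σ r)) 0 := by
    rw [hQ, sum_map]
    exact sum_le_sum fun r hr => max_le_max (sub_le_sub_left (h r hr) c) le_rfl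
  have hQv : val v Q = #R * c + ∑ q ∈ Q, max (v q - c) 0 - ∑ q ∈ Q, max (c - v q) 0 := by
    rw [_root_.val, sum_congr rfl fun q _ => hsplit (v q), sum_sub_distrib, sum_add_distrib]
    simp [hQ]
  have hRv : val (v ∘ σ) R = #R * c + ∑ r ∈ R, max (v (σ r) - c) 0 -
      ∑ r ∈ R, max (c - v (σ r)) 0 := by
    rw [_root_.val, sum_congr rfl fun r _ => hsplit ((v ∘ σ) r), sum_sub_distrib, sum_add_distrib]
    simp
  rw [sum_insert hs] at hpos
  have h1 := hsplit (v (σ s))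
  have h2 : 0 ≤ max (c - v (σ s)) 0 := le_max_right _ _
  linarith

theorem exists_antitone_equiv {ι : Type*} [Fintype ι] (v : ι → ℝ) :
    ∃ σ : Fin (Fintype.card ι) ≃ ι, Antitone (v ∘ σ) := by
  set e := (Fintype.equivFin ι).symm
  refine ⟨(Tuple.sort fun r => -v (e r)).trans e, fun r s hrs => ?_⟩
  have := Tuple.monotone_sort (fun r => -v (e r)) hrs
  simpa using this

/-- A theorem of the alternative: if every nonnegative weighting is nonnegative at some point of
a finite family, then a convex combination of the family is nonnegative. -/
theorem exists_convex_combination_nonneg {A : Type*} [Fintype A] {n : ℕ} (x : A → Fin n → ℝ)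
    (h : ∀ w : Fin n → ℝ, (∀ i, 0 ≤ w i) → ∃ a, 0 ≤ ∑ i, w i * x a i) :
    ∃ p : A → ℝ, (∀ a, 0 ≤ p a) ∧ ∑ a, p a = 1 ∧ ∀ i, 0 ≤ ∑ a, p a * x a i := by
  classical
  by_contra! hcon
  set L : (A → ℝ) →ₗ[ℝ] (Fin n → ℝ) := Fintype.linearCombination ℝ x with hL
  have hLi : ∀ p i, L p i = ∑ a, p a * x a i := fun p i => by
    simp [hL, Fintype.linearCombination_apply]
  have hdisj : Disjoint (L '' stdSimplex ℝ A) (Set.Ici 0) := by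
    rw [Set.disjoint_left]
    rintro _ ⟨p, hp, rfl⟩ hy
    obtain ⟨i, hi⟩ := hcon p hp.1 hp.2
    have := hy i
    rw [hLi] at this
    exact absurd this (not_le.2 hi)
  obtain ⟨f, s, t, hs, hst, ht⟩ := geometric_hahn_banach_compact_closed
    ((convex_stdSimplex ℝ A).linear_image L)
    ((isCompact_stdSimplex ℝ A).image L.continuous_of_finiteDimensional)
    (convex_Ici (𝕜 := ℝ) (0 : Fin n → ℝ)) isClosed_Ici hdisj
  have ht0 : t < 0 := by simpa using ht 0 (Set.mem_Ici.2 le_rfl)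
  have hw : ∀ i, 0 ≤ f (Pi.single i 1) := by
    intro i
    by_contra! hneg
    have := ht ((t / f (Pi.single i 1)) • Pi.single i 1)
      (Set.mem_Ici.2 (smul_nonneg (div_nonneg_of_nonpos ht0.le hneg.le)
        (Pi.single_nonneg.2 zero_le_one)))
    rw [map_smul, smul_eq_mul, div_mul_cancel₀ _ hneg.ne] at this
    exact lt_irrefl _ this
  obtain ⟨a, ha⟩ := h _ hw
  have h1 := hs (x a) ⟨Pi.single a 1, single_mem_stdSimplex ℝ a, by
    ext i; simp [hLi, Pi.single_apply]⟩
  have h2 : f (x a) = ∑ i, f (Pi.single i 1) * x a i := by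
    conv_lhs => rw [pi_eq_sum_univ' (x a)]
    simp [map_sum, mul_comm]
  linarith

theorem exists_smaller_support {A : Type*} [Fintype A] {n : ℕ} (hn : 1 ≤ n) (x : A → Fin n → ℝ)
    (p : A → ℝ) (hp0 : ∀ a, 0 ≤ p a) (hcard : n < #{a | p a ≠ 0}) :
    ∃ q : A → ℝ, (∀ a, 0 ≤ q a) ∧ ∑ a, q a = ∑ a, p a ∧
      (∀ i, ∑ a, p a * x a i ≤ ∑ a, q a * x a i) ∧ #{a | q a ≠ 0} < #{a | p a ≠ 0} := by
  classical
  set i₀ : Fin n := ⟨0, hn⟩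
  set S : Finset A := {a | p a ≠ 0} with hS
  set y : A → Fin n → ℝ := fun a => Function.update (x a) i₀ 1 with hy
  set L : (A → ℝ) →ₗ[ℝ] (Fin n → ℝ) × ({a // a ∉ S} → ℝ) :=
    (Fintype.linearCombination ℝ y).prod (LinearMap.funLeft ℝ ℝ Subtype.val) with hL
  have hker : LinearMap.ker L ≠ ⊥ := by
    apply LinearMap.ker_ne_bot_of_finrank_lt
    have h1 : Fintype.card {a // a ∉ S} = Fintype.card A - #S := by
      rw [Fintype.card_subtype_compl, Fintype.card_coe]
    have h2 : #S ≤ Fintype.card A := card_le_univ S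
    simp only [Module.finrank_prod, Module.finrank_fintype_fun_eq_card, Fintype.card_fin, h1]
    omega
  obtain ⟨d', hd', hd'0⟩ := (Submodule.ne_bot_iff _).1 hker
  obtain ⟨d, hd, hd0, hdpos⟩ : ∃ d, d ∈ LinearMap.ker L ∧ d ≠ 0 ∧ 0 ≤ ∑ a, d a * x a i₀ := by
    rcases le_total 0 (∑ a, d' a * x a i₀) with h | h
    · exact ⟨d', hd', hd'0, h⟩
    · exact ⟨-d', neg_mem hd', neg_ne_zero.2 hd'0, by simpa using h⟩
  obtain ⟨hd1, hd2⟩ : Fintype.linearCombination ℝ y d = 0 ∧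
      LinearMap.funLeft ℝ ℝ (Subtype.val : {a // a ∉ S} → A) d = 0 := by
    simpa [hL, Prod.ext_iff] using hd
  have hdS : ∀ a ∉ S, d a = 0 := fun a ha => congrFun hd2 ⟨a, ha⟩
  have hdy : ∀ i, ∑ a, d a * y a i = 0 := fun i => by
    simpa [Fintype.linearCombination_apply] using congrFun hd1 i
  have hdsum : ∑ a, d a = 0 := by simpa [hy] using hdy i₀
  have hdx : ∀ i, 0 ≤ ∑ a, d a * x a i := fun i => by
    by_cases hi : i = i₀
    · rwa [hi]
    · refine (le_of_eq ?_)
      rw [← hdy i]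
      simp [hy, hi]
  have hneg : ({a | d a < 0} : Finset A).Nonempty := by
    by_contra hcon
    have h0 : ∀ a, 0 ≤ d a := fun a => by
      by_contra! ha
      exact hcon ⟨a, by simpa using ha⟩
    exact hd0 (funext fun a => (sum_eq_zero_iff_of_nonneg fun a _ => h0 a).1 hdsum a (mem_univ a))
  obtain ⟨b, hb, hbmin⟩ := exists_min_image _ (fun a => p a / -d a) hneg
  have hb' : d b < 0 := by simpa using hb
  have hbS : b ∈ S := by
    by_contra h
    exact hb'.ne (hdS b h)
  set t := p b / -d b
  have ht0 : 0 ≤ t := div_nonneg (hp0 b) (by linarith)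
  refine ⟨fun a => p a + t * d a, fun a => ?_, ?_, fun i => ?_, card_lt_card ?_⟩
  · rcases lt_or_ge (d a) 0 with ha | ha
    · have := hbmin a (by simpa using ha)
      rw [le_div_iff₀ (by linarith)] at this
      linarith
    · have := mul_nonneg ht0 ha
      have := hp0 a
      linarith
  · rw [sum_add_distrib, ← mul_sum, hdsum, mul_zero, add_zero]
  · have : ∑ a, (p a + t * d a) * x a i = ∑ a, p a * x a i + t * ∑ a, d a * x a i := by
      rw [mul_sum, ← sum_add_distrib]
      exact sum_congr rfl fun a _ => by ring
    rw [this]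
    linarith [mul_nonneg ht0 (hdx i)]
  · refine (ssubset_iff_of_subset fun a ha => ?_).2 ⟨b, hbS, ?_⟩
    · by_contra haS
      have h1 := hdS a haS
      have h2 : p a = 0 := by simpa [hS] using haS
      simp [h1, h2] at ha
    · have : t * -d b = p b := div_mul_cancel₀ _ (by linarith)
      simp only [mem_filter_univ, ne_eq, not_not]
      linarith

theorem exists_support_le {A : Type*} [Fintype A] {n : ℕ} (hn : 1 ≤ n) (x : A → Fin n → ℝ)
    (p : A → ℝ) (hp0 : ∀ a, 0 ≤ p a) :
    ∃ q : A → ℝ, (∀ a, 0 ≤ q a) ∧ ∑ a, q a = ∑ a, p a ∧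
      (∀ i, ∑ a, p a * x a i ≤ ∑ a, q a * x a i) ∧ #{a | q a ≠ 0} ≤ n := by
  induction hc : #{a | p a ≠ 0} using Nat.strong_induction_on generalizing p with
  | _ c ih =>
  by_cases hle : #{a | p a ≠ 0} ≤ n
  · exact ⟨p, hp0, rfl, fun _ => le_rfl, hle⟩
  obtain ⟨q, hq0, hq1, hqx, hqc⟩ := exists_smaller_support hn x p hp0 (not_le.1 hle)
  obtain ⟨r, hr0, hr1, hrx, hrc⟩ := ih _ (hc ▸ hqc) q hq0 rfl
  exact ⟨r, hr0, hr1.trans hq1, fun i => (hqx i).trans (hrx i), hrc⟩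

theorem isMMS.le_sum_min {ι : Type*} [Fintype ι] [DecidableEq ι] {n : ℕ} {v : ι → ℝ} {μ : ℝ}
    (h : isMMS n v μ) (hv : ∀ j, 0 ≤ v j) (hμ : 0 ≤ μ) : n * μ ≤ ∑ j, min (v j) μ := by
  obtain ⟨⟨Q, ⟨hdisj, hcov⟩, hQ⟩, -⟩ := h
  rw [← hcov, sum_biUnion fun i _ j _ hij => hdisj i j hij]
  have hle : ∀ i, μ ≤ val v (Q i) := fun i => hQ ▸ ciInf_le (Set.finite_range _).bddBelow i
  have hmin : ∀ i, μ ≤ ∑ j ∈ Q i, min (v j) μ := by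
    intro i
    by_cases hbig : ∃ j ∈ Q i, μ ≤ v j
    · obtain ⟨j, hj, hjμ⟩ := hbig
      calc μ = min (v j) μ := (min_eq_right hjμ).symm
        _ ≤ _ := single_le_sum (f := fun j => min (v j) μ) (fun j _ => le_min (hv j) hμ) hj
    · push Not at hbig
      rw [sum_congr rfl fun j hj => min_eq_left (hbig j hj).le]
      exact hle i
  simpa using card_nsmul_le_sum univ _ μ fun i _ => hmin i

theorem isTPS.le_sum_min {ι : Type*} {k : ℕ} (hk : 1 ≤ k) {S : Finset ι} {v : ι → ℝ} {t : ℝ}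
    (h : isTPS k S v t) : k * t ≤ ∑ j ∈ S, min (v j) t := by
  have h1 := h.1.2
  rw [div_eq_iff (by positivity)] at h1
  rw [h1, mul_comm]

/-- The allocation in which item `j` is given to agent `b j`. -/
def ownerBundle {ι : Type*} [Fintype ι] {n : ℕ} (b : ι → Fin n) (i : Fin n) : Finset ι :=
  {j | b j = i}

theorem isAlloc_ownerBundle {ι : Type*} [Fintype ι] [DecidableEq ι] {n : ℕ} (b : ι → Fin n) :
    isAlloc (ownerBundle b) := by
  refine ⟨fun i j hij => ?_, ?_⟩
  · rw [Finset.disjoint_left]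
    intro x hx hx'
    simp only [ownerBundle, mem_filter_univ] at hx hx'
    exact hij (hx.symm.trans hx')
  · ext x
    simp [ownerBundle]

theorem exists_fair_owner {ι : Type*} [Fintype ι] [DecidableEq ι] (n : ℕ) (hn : 1 ≤ n)
    (v : Fin n → ι → ℝ) (hv : ∀ i j, 0 ≤ v i j) (T : Fin n → ℝ) (hT0 : ∀ i, 0 ≤ T i)
    (hT : ∀ i, n * T i ≤ ∑ j, min (v i j) (T i)) (w : Fin n → ℝ) (hw : ∀ i, 0 ≤ w i) :
    ∃ b : ι → Fin n, (∀ i, T i / 2 ≤ val (v i) (ownerBundle b i)) ∧ isProp1 v (ownerBundle b) ∧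
      ∑ i, w i * (val (v i) univ / n) ≤ ∑ i, w i * val (v i) (ownerBundle b i) := by
  choose σ hσ using fun i => exists_antitone_equiv (v i)
  have hsum : ∀ i, val (v i ∘ σ i) univ = val (v i) univ := fun i => (σ i).sum_comp (v i)
  obtain ⟨o, -, hfair, hwel⟩ := exists_fair_assignment (fun i => v i ∘ σ i)
    (fun i r => hv i _) hσ w hw T hT0 univ ⟨⟨0, hn⟩, mem_univ _⟩ univ (fun i _ => by
      rw [card_univ, Fintype.card_fin]
      exact (hT i).trans_eq ((σ i).sum_comp fun j => min (v i j) (T i)).symm)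
  simp only [card_univ, Fintype.card_fin, hsum, mem_univ, true_and, forall_true_left] at hfair hwel
  obtain ⟨π, hπ⟩ := exists_picking_sequence σ o
  have hmap : ∀ i, ownerBundle (o ∘ π.symm) i = ({r | o r = i} : Finset _).map π.toEmbedding := by
    intro i
    ext j
    simp [ownerBundle]
  have hdom : ∀ i, ∀ r ∈ ({r | o r = i} : Finset _), v i (σ i r) ≤ v i (π r) := by
    intro i r hr
    obtain rfl : o r = i := by simpa using hr
    have := hσ (o r) (hπ r)
    simpa using this
  have hval : ∀ i, val (v i ∘ σ i) {r | o r = i} ≤ val (v i) (ownerBundle (o ∘ π.symm) i) :=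
    fun i => by rw [hmap]; exact val_le_val_map _ _ _ _ (hdom i)
  refine ⟨o ∘ π.symm, fun i => (hfair i).1.trans (hval i), fun i => ?_,
    hwel.trans (sum_le_sum fun i _ => mul_le_mul_of_nonneg_left (hval i) (hw i))⟩
  rcases (hfair i).2 with h | ⟨s, hs, h⟩
  · exact .inl (h.trans (hval i))
  · rcases exists_add_le_val_map (v i) (σ i) π _ (hdom i) s (by simpa using hs) with
      hQ | ⟨j, hj, hjv⟩
    · left
      rw [hmap, hQ]
      have : 0 ≤ val (v i) univ := sum_nonneg fun j _ => hv i j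
      exact div_le_self this (by exact_mod_cast hn)
    · rw [← hmap] at hj hjv
      exact .inr ⟨j, hj, h.trans hjv⟩

/-- there is a randomized allocation supported on at most `n`
allocations that is ex-ante proportional, and every allocation in its support
gives every agent at least half her TPS (hence at least half her MMS) and is Prop1. -/
theorem stmt7 {ι : Type*} [Fintype ι] [DecidableEq ι] (n : ℕ) (hn : 1 ≤ n)
    (v : Fin n → ι → ℝ) (hv : ∀ i j, 0 ≤ v i j)
    (tps mms : Fin n → ℝ)
    (htps : ∀ i, isTPS n Finset.univ (v i) (tps i))
    (hmms : ∀ i, isMMS n (v i) (mms i)) :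
    ∃ (ℓ : ℕ) (A : Fin ℓ → Fin n → Finset ι) (p : Fin ℓ → ℝ),
      ℓ ≤ n ∧
      (∀ k, 0 ≤ p k) ∧ (∑ k, p k = 1) ∧ (∀ k, isAlloc (A k)) ∧
      (∀ i, (∑ k, p k * val (v i) (A k i)) ≥ val (v i) Finset.univ / n) ∧
      (∀ k, 0 < p k →
        (∀ i, val (v i) (A k i) ≥ (1 / 2) * tps i) ∧
        (∀ i, val (v i) (A k i) ≥ (1 / 2) * mms i) ∧
        isProp1 v (A k)) := by
  classical
  set T : Fin n → ℝ := fun i => max (tps i) (mms i) with hTdef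
  have hT0 : ∀ i, 0 ≤ T i := fun i => (htps i).1.1.trans (le_max_left _ _)
  have hT : ∀ i, n * T i ≤ ∑ j, min (v i j) (T i) := by
    intro i
    rcases le_total (mms i) (tps i) with h | h
    · simp only [hTdef, max_eq_left h]
      exact (htps i).le_sum_min hn
    · simp only [hTdef, max_eq_right h]
      exact (hmms i).le_sum_min (hv i) ((htps i).1.1.trans h)
  let Good := {b : ι → Fin n // (∀ i, T i / 2 ≤ val (v i) (ownerBundle b i)) ∧
    isProp1 v (ownerBundle b)}
  let x : Good → Fin n → ℝ := fun b i => val (v i) (ownerBundle b.1 i) - val (v i) univ / n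
  obtain ⟨p, hp0, hp1, hpx⟩ := exists_convex_combination_nonneg x fun w hw => by
    obtain ⟨b, hbT, hbP, hbw⟩ := exists_fair_owner n hn v hv T hT0 hT w hw
    refine ⟨⟨b, hbT, hbP⟩, ?_⟩
    simp only [x, mul_sub, sum_sub_distrib]
    linarith
  obtain ⟨q, hq0, hq1, hqx, hqc⟩ := exists_support_le hn x p hp0
  rw [hp1] at hq1
  set S : Finset Good := {a | q a ≠ 0} with hS
  have hsumS : ∀ f : Good → ℝ, ∑ k, q (S.equivFin.symm k) * f (S.equivFin.symm k) =
      ∑ a, q a * f a := by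
    intro f
    rw [S.equivFin.symm.sum_comp fun a : S => q a * f a, sum_coe_sort S fun a => q a * f a]
    refine sum_subset (subset_univ _) fun a _ ha => ?_
    have : q a = 0 := by simpa [hS] using ha
    rw [this, zero_mul]
  refine ⟨#S, fun k => ownerBundle (S.equivFin.symm k).1.1, fun k => q (S.equivFin.symm k), hqc,
    fun k => hq0 _, ?_, fun k => isAlloc_ownerBundle _, fun i => ?_, fun k _ => ⟨fun i => ?_,
    fun i => ?_, (S.equivFin.symm k).1.2.2⟩⟩
  · simpa [hq1] using hsumS fun _ => 1
  · have h1 := (hpx i).trans (hqx i)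
    simp only [x, mul_sub, sum_sub_distrib, ← sum_mul, hq1, one_mul] at h1
    rw [hsumS fun a => val (v i) (ownerBundle a.1 i)]
    linarith
  · have := (S.equivFin.symm k).1.2.1 i
    have := le_max_left (tps i) (mms i)
    simp only [hTdef] at *
    linarith
  · have := (S.equivFin.symm k).1.2.1 i
    have := le_max_right (tps i) (mms i)
    simp only [hTdef] at *
    linarith
end

section
/- For every allocation instance with n agents and additive valuations, there exists a randomized allocation supported on at most n allocations that is ex-ante proportional, and such that every allocation A in its support gives every agent i value v_i(A_i) ≥ (1/2)·TPS_i (and hence at least half her MMS) and is Pareto optimal. -/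
open Finset

/-- An allocation is Pareto optimal if no allocation Pareto dominates it. -/
def isPO {ι : Type*} [Fintype ι] [DecidableEq ι] {n : ℕ} (v : Fin n → ι → ℝ)
    (A : Fin n → Finset ι) : Prop :=
  ¬ ∃ B : Fin n → Finset ι, isAlloc B ∧
      (∀ i, val (v i) (A i) ≤ val (v i) (B i)) ∧
      (∃ i, val (v i) (A i) < val (v i) (B i))

/-- If every nonnegative weighting of the coordinates is nonnegative on one of finitely many
points, then their convex hull meets the nonnegative orthant. -/
theorem convexHull_inter_nonneg_nonempty {κ : Type*} [Finite κ] {n : ℕ} (z : κ → Fin n → ℝ)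
    (h : ∀ w : Fin n → ℝ, (∀ i, 0 ≤ w i) → ∃ k, 0 ≤ ∑ i, w i * z k i) :
    (convexHull ℝ (Set.range z) ∩ {y | ∀ i, 0 ≤ y i}).Nonempty := by
  by_contra hne
  rw [Set.not_nonempty_iff_eq_empty, ← Set.disjoint_iff_inter_eq_empty] at hne
  have hconv : Convex ℝ {y : Fin n → ℝ | ∀ i, 0 ≤ y i} := by
    intro x hx y hy a b ha hb _ i
    simp only [Pi.add_apply, Pi.smul_apply, smul_eq_mul]
    have := mul_nonneg ha (hx i)
    have := mul_nonneg hb (hy i)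
    positivity
  have hclosed : IsClosed {y : Fin n → ℝ | ∀ i, 0 ≤ y i} := by
    simp only [Set.ofPred_forall]
    exact isClosed_iInter fun i => isClosed_le continuous_const (continuous_apply i)
  obtain ⟨f, a, b, hfa, hab, hfb⟩ := geometric_hahn_banach_compact_closed (convex_convexHull ℝ _)
    ((Set.finite_range z).isCompact_convexHull ℝ) hconv hclosed hne
  have hb0 : b < 0 := by simpa using hfb 0 (fun i => le_rfl)
  have hw : ∀ i, 0 ≤ f (Pi.single i 1) := by
    intro i
    by_contra! hneg
    have := hfb ((b / f (Pi.single i 1)) • Pi.single i 1) (fun j => by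
      have h1 : 0 ≤ b / f (Pi.single i 1) := (div_pos_of_neg_of_neg hb0 hneg).le
      have h2 : (0 : ℝ) ≤ (Pi.single i (1 : ℝ) : Fin n → ℝ) j := by
        by_cases hij : j = i
        · subst hij; simp
        · simp [hij]
      exact mul_nonneg h1 h2)
    rw [map_smul, smul_eq_mul, div_mul_cancel₀ _ hneg.ne] at this
    exact lt_irrefl _ this
  obtain ⟨k, hk⟩ := h _ hw
  have hsum : f (z k) = ∑ i, f (Pi.single i 1) * z k i := by
    conv_lhs => rw [pi_eq_sum_univ' (z k)]
    rw [map_sum]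
    refine Finset.sum_congr rfl fun i _ => ?_
    rw [map_smul, smul_eq_mul, mul_comm]
  have := hfa (z k) (subset_convexHull ℝ _ ⟨k, rfl⟩)
  linarith

/-- A polytope in dimension `n ≥ 1` that meets the nonnegative orthant does so in a convex
combination of at most `n` of its generators. -/
theorem exists_convexCombination_nonneg {κ : Type*} [Finite κ] {n : ℕ} (hn : 1 ≤ n)
    (z : κ → Fin n → ℝ)
    (h : (convexHull ℝ (Set.range z) ∩ {y | ∀ i, 0 ≤ y i}).Nonempty) :
    ∃ (ℓ : ℕ) (K : Fin ℓ → κ) (p : Fin ℓ → ℝ), ℓ ≤ n ∧ (∀ k, 0 ≤ p k) ∧ ∑ k, p k = 1 ∧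
      ∀ i, 0 ≤ ∑ k, p k * z (K k) i := by
  have hclosed : IsClosed {y : Fin n → ℝ | ∀ i, 0 ≤ y i} := by
    simp only [Set.ofPred_forall]
    exact isClosed_iInter fun i => isClosed_le continuous_const (continuous_apply i)
  have hcomp : IsCompact (convexHull ℝ (Set.range z) ∩ {y : Fin n → ℝ | ∀ i, 0 ≤ y i}) :=
    ((Set.finite_range z).isCompact_convexHull ℝ).inter_right hclosed
  have hcont : Continuous fun y : Fin n → ℝ => ∑ i, y i := by fun_prop
  obtain ⟨y, ⟨hyc, hy0⟩, hmax⟩ := hcomp.exists_isMaxOn h hcont.continuousOn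
  obtain ⟨J, _, q, p, hq, haff, hp, hp1, hpy⟩ := eq_pos_convex_span_of_mem_convexHull hyc
  have hcard : Fintype.card J ≤ n := by
    by_contra! hlt
    have hle := haff.card_le_finrank_succ
    have hle' : Module.finrank ℝ (vectorSpan ℝ (Set.range q)) ≤ n := by
      simpa using Submodule.finrank_le (vectorSpan ℝ (Set.range q))
    have htop := haff.affineSpan_eq_top_iff_card_eq_finrank_add_one.2 (by simp; omega)
    let B : AffineBasis J ℝ (Fin n → ℝ) := ⟨q, haff, htop⟩
    have hint : y ∈ interior (convexHull ℝ (Set.range z)) := by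
      refine interior_mono (convexHull_mono hq) ?_
      have hB := B.interior_convexHull
      change interior (convexHull ℝ (Set.range q)) = _ at hB
      rw [hB]
      intro i
      have hcomb : y = Finset.univ.affineCombination ℝ B p := by
        rw [Finset.affineCombination_eq_linear_combination _ _ _ hp1]
        exact hpy.symm
      rw [hcomb, B.coord_apply_combination_of_mem (Finset.mem_univ i) hp1]
      exact hp i
    have htend : Filter.Tendsto (fun ε : ℝ => y + ε • (1 : Fin n → ℝ)) (nhdsWithin 0 (Set.Ioi 0))
        (nhds y) := by
      have : Continuous (fun ε : ℝ => y + ε • (1 : Fin n → ℝ)) := by fun_prop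
      simpa using (this.tendsto 0).mono_left nhdsWithin_le_nhds
    obtain ⟨ε, hε, hε0⟩ := ((htend.eventually (mem_interior_iff_mem_nhds.1 hint)).and
      self_mem_nhdsWithin).exists
    have hε0 : 0 < ε := hε0
    have := hmax (a := y + ε • (1 : Fin n → ℝ)) ⟨hε, fun i => by
      have := hy0 i
      simp; linarith⟩
    simp [Finset.sum_add_distrib] at this
    have hn' : (1 : ℝ) ≤ n := by exact_mod_cast hn
    nlinarith
  choose K hK using fun k : J => hq ⟨k, rfl⟩
  let e := Fintype.equivFin J
  refine ⟨Fintype.card J, fun k => K (e.symm k), fun k => p (e.symm k), hcard,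
    fun k => (hp _).le, by rw [e.symm.sum_comp p, hp1], fun i => ?_⟩
  have h1 : ∑ k, p (e.symm k) * z (K (e.symm k)) i = ∑ k, p k * z (K k) i :=
    e.symm.sum_comp fun k => p k * z (K k) i
  rw [h1]
  have h2 : y i = ∑ k, p k * z (K k) i := by
    rw [← hpy, Finset.sum_apply]
    exact Finset.sum_congr rfl fun k _ => by rw [hK]; simp
  rw [← h2]
  exact hy0 i

/-- A bipartite graph with `n` left vertices, all of degree at most `n`, carries for any edge weights
a matching whose weight is at least a `1 / n` fraction of the total. -/
theorem exists_matching_weight_ge {ι : Type*} [Fintype ι] [DecidableEq ι] [Nonempty ι]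
    {n : ℕ} (hn : 1 ≤ n) (S : Fin n → Finset ι) (hS : ∀ i, (S i).card ≤ n)
    (c : Fin n → ι → ℝ) :
    ∃ (F : Finset (Fin n)) (f : Fin n → ι), Set.InjOn f F ∧ (∀ i ∈ F, f i ∈ S i) ∧
      (∑ i, ∑ j ∈ S i, c i j) / n ≤ ∑ i ∈ F, c i (f i) := by
  classical
  have hn0 : (0 : ℝ) < n := by exact_mod_cast hn
  let X : Matrix (Fin n) ι ℝ := fun i j => if j ∈ S i then 1 / n else 0
  have hX0 : ∀ i j, 0 ≤ X i j := fun i j => by simp only [X]; split_ifs <;> positivity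
  have hrow : ∀ i, ∑ j, X i j ≤ 1 := fun i => by
    simp only [X, Finset.sum_ite_mem, Finset.univ_inter, Finset.sum_const, nsmul_eq_mul]
    rw [mul_one_div, div_le_one hn0]
    exact_mod_cast hS i
  have hcol : ∀ j, ∑ i, X i j ≤ 1 := fun j => by
    calc ∑ i, X i j ≤ ∑ _i : Fin n, (1 / n : ℝ) := by
          refine Finset.sum_le_sum fun i _ => ?_
          simp only [X]; split_ifs <;> [exact le_rfl; positivity]
      _ = 1 := by simp [hn0.ne']
  let M : Matrix (Fin n ⊕ ι) (Fin n ⊕ ι) ℝ :=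
    Matrix.of fun a b => match a, b with
      | .inl i, .inl k => if i = k then 1 - ∑ j, X i j else 0
      | .inl i, .inr j => X i j
      | .inr j, .inl i => X i j
      | .inr j, .inr l => if j = l then 1 - ∑ i, X i j else 0
  have hM : M ∈ doublyStochastic ℝ (Fin n ⊕ ι) := by
    rw [mem_doublyStochastic_iff_sum]
    refine ⟨?_, ?_, ?_⟩
    · rintro (i | j) (k | l) <;> simp only [M, Matrix.of_apply]
      · split_ifs <;> [linarith [hrow i]; exact le_rfl]
      · exact hX0 _ _
      · exact hX0 _ _
      · split_ifs <;> [linarith [hcol j]; exact le_rfl]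
    · rintro (i | j) <;> simp [M, Fintype.sum_sum_type]
    · rintro (i | j) <;> simp [M, Fintype.sum_sum_type]
  obtain ⟨q, hq0, hq1, hqM⟩ := exists_eq_sum_perm_of_mem_doublyStochastic hM
  let C : Equiv.Perm (Fin n ⊕ ι) → ℝ := fun σ =>
    ∑ i, ∑ j ∈ S i, if σ (.inl i) = .inr j then c i j else 0
  have havg : ∑ σ, q σ * C σ = (∑ i, ∑ j ∈ S i, c i j) / n := by
    have hentry : ∀ i, ∀ j ∈ S i, ∑ σ, q σ * (if σ (.inl i) = .inr j then 1 else 0) = 1 / n := by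
      intro i j hj
      have := congrFun (congrFun hqM (.inl i)) (.inr j)
      simp only [M, Matrix.of_apply, X, if_pos hj, Matrix.sum_apply, Matrix.smul_apply,
        smul_eq_mul, Equiv.Perm.permMatrix, PEquiv.toMatrix_apply, Equiv.toPEquiv_apply,
        Option.mem_def, Option.some.injEq] at this
      rw [← this]
    simp only [C, Finset.mul_sum]
    rw [Finset.sum_comm, Finset.sum_div]
    refine Finset.sum_congr rfl fun i _ => ?_
    rw [Finset.sum_comm, Finset.sum_div]
    refine Finset.sum_congr rfl fun j hj => ?_
    rw [div_eq_mul_one_div, ← hentry i j hj, Finset.mul_sum]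
    refine Finset.sum_congr rfl fun σ _ => ?_
    split_ifs <;> ring
  obtain ⟨σ, hσ⟩ : ∃ σ, (∑ i, ∑ j ∈ S i, c i j) / n ≤ C σ := by
    by_contra! hlt
    have h1 : ∑ σ, q σ * C σ < (∑ i, ∑ j ∈ S i, c i j) / n := by
      obtain ⟨τ, -, hτ⟩ : ∃ τ ∈ Finset.univ, 0 < q τ := by
        apply Finset.exists_lt_of_sum_lt
        simp [hq1]
      calc ∑ σ, q σ * C σ < ∑ σ, q σ * ((∑ i, ∑ j ∈ S i, c i j) / n) :=
            Finset.sum_lt_sum (fun σ _ => mul_le_mul_of_nonneg_left (hlt σ).le (hq0 σ))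
              ⟨τ, Finset.mem_univ _, mul_lt_mul_of_pos_left (hlt τ) hτ⟩
        _ = _ := by rw [← Finset.sum_mul, hq1, one_mul]
    exact h1.ne havg
  let f : Fin n → ι := fun i => (σ (.inl i)).elim (fun _ => Classical.arbitrary ι) id
  let F : Finset (Fin n) := Finset.univ.filter fun i => ∃ j ∈ S i, σ (.inl i) = .inr j
  have hfF : ∀ i ∈ F, f i ∈ S i ∧ σ (.inl i) = .inr (f i) := by
    intro i hi
    obtain ⟨j, hj, hij⟩ := (Finset.mem_filter.1 hi).2
    simp [f, hij, hj]
  refine ⟨F, f, ?_, fun i hi => (hfF i hi).1, hσ.trans (le_of_eq ?_)⟩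
  · intro i hi k hk hik
    have h1 := (hfF i hi).2
    have h2 := (hfF k hk).2
    rw [hik, ← h2] at h1
    simpa using σ.injective h1
  · rw [Finset.sum_filter]
    refine Finset.sum_congr rfl fun i _ => ?_
    split_ifs with hi
    · have h1 := hfF i (Finset.mem_filter.2 ⟨Finset.mem_univ _, hi⟩)
      rw [Finset.sum_eq_single_of_mem (f i) h1.1]
      · simp [h1.2]
      · intro j _ hj
        rw [if_neg]
        rw [h1.2]
        simpa using fun h => hj h.symm
    · refine Finset.sum_eq_zero fun j hj => if_neg fun h => hi ⟨j, hj, h⟩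

theorem isTPS.sum_min_eq {ι : Type*} {n : ℕ} (hn : 1 ≤ n) {S : Finset ι} {v : ι → ℝ} {t : ℝ}
    (h : isTPS n S v t) : ∑ j ∈ S, min (v j) t = n * t := by
  have hn0 : (0 : ℝ) < n := by exact_mod_cast hn
  have := h.1.2
  rw [div_eq_iff hn0.ne'] at this
  rw [this, mul_comm]

theorem isTPS.sum_min_lt {ι : Type*} {n : ℕ} (hn : 1 ≤ n) {S : Finset ι} {v : ι → ℝ} {t s : ℝ}
    (h : isTPS n S v t) (hs : t < s) : ∑ j ∈ S, min (v j) s < n * s := by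
  have hn0 : (1 : ℝ) ≤ n := by exact_mod_cast hn
  have ht := h.1.1
  by_contra! hge
  let g : ℝ → ℝ := fun s => ∑ j ∈ S, min (v j) s - n * s
  have hg : Continuous g := by fun_prop
  let b := max s (∑ j ∈ S, v j)
  have hgb : g b ≤ 0 := by
    have h1 : ∑ j ∈ S, min (v j) b ≤ ∑ j ∈ S, v j :=
      Finset.sum_le_sum fun j _ => min_le_left _ _
    have h2 : s ≤ b := le_max_left _ _
    have h3 : ∑ j ∈ S, v j ≤ b := le_max_right _ _
    have : b ≤ n * b := by nlinarith
    simp only [g]; linarith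
  obtain ⟨r, ⟨hr, -⟩, hr0⟩ := intermediate_value_Icc' (le_max_left s (∑ j ∈ S, v j))
    hg.continuousOn ⟨hgb, by simp only [g]; linarith⟩
  have : r ≤ t := h.2 ⟨by linarith, by
    rw [div_eq_iff (by positivity)]
    simp only [g] at hr0; linarith⟩
  linarith

theorem isTPS.card_lt_le {ι : Type*} {n : ℕ} (hn : 1 ≤ n) {S : Finset ι} {v : ι → ℝ} {t : ℝ}
    (h : isTPS n S v t) : (S.filter fun j => t < v j).card ≤ n := by
  by_contra! hlt
  have hne : (S.filter fun j => t < v j).Nonempty := Finset.card_pos.1 (by omega)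
  obtain ⟨j₀, hj₀, hmin⟩ := Finset.exists_min_image _ v hne
  have hts := (Finset.mem_filter.1 hj₀).2
  have h1 := h.sum_min_lt hn hts
  have h2 : ∑ j ∈ S, min (v j) t + (S.filter fun j => t < v j).card * (v j₀ - t) ≤
      ∑ j ∈ S, min (v j) (v j₀) := by
    rw [← nsmul_eq_mul, ← Finset.sum_const, Finset.sum_filter, ← Finset.sum_add_distrib]
    refine Finset.sum_le_sum fun j hj => ?_
    split_ifs with hjt
    · have := hmin j (Finset.mem_filter.2 ⟨hj, hjt⟩)
      rw [min_eq_right hjt.le, min_eq_right this]; linarith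
    · rw [min_eq_left (not_lt.1 hjt), min_eq_left (by linarith)]; simp
  rw [h.sum_min_eq hn] at h2
  have h3 : (n : ℝ) < (S.filter fun j => t < v j).card := by exact_mod_cast hlt
  nlinarith

theorem isMMS.le_tps {ι : Type*} [Fintype ι] [DecidableEq ι] {n : ℕ} (hn : 1 ≤ n) {v : ι → ℝ}
    (hv : ∀ j, 0 ≤ v j) {t μ : ℝ} (ht : isTPS n Finset.univ v t) (hμ : isMMS n v μ) : μ ≤ t := by
  by_contra! hlt
  have h1 := ht.sum_min_lt hn hlt
  have hμ0 : 0 ≤ μ := ht.1.1.trans hlt.le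
  obtain ⟨P, hP, hPμ⟩ := hμ.1
  have h2 : ∀ i, μ ≤ val v (P i) := fun i => by
    rw [hPμ]
    exact ciInf_le (Set.finite_range _).bddBelow i
  have h3 : ∀ i, μ ≤ ∑ j ∈ P i, min (v j) μ := by
    intro i
    by_cases hbig : ∃ j ∈ P i, μ ≤ v j
    · obtain ⟨j, hj, hjμ⟩ := hbig
      calc μ = min (v j) μ := (min_eq_right hjμ).symm
        _ ≤ _ := Finset.single_le_sum (f := fun j => min (v j) μ)
          (fun j _ => le_min (hv j) hμ0) hj
    · push Not at hbig
      rw [Finset.sum_congr rfl fun j hj => min_eq_left (hbig j hj).le]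
      exact h2 i
  have h4 : ∑ j, min (v j) μ = ∑ i, ∑ j ∈ P i, min (v j) μ := by
    rw [← hP.2, Finset.sum_biUnion fun i _ j _ hij => hP.1 i j hij]
  rw [h4] at h1
  have h5 : ∑ _i : Fin n, μ ≤ ∑ i, ∑ j ∈ P i, min (v j) μ := Finset.sum_le_sum fun i _ => h3 i
  simp at h5
  linarith

/-- Rounding a fractional assignment of the items in `β` to the agents in `α`: some integral
assignment inside its support has at least its `c`-weight, and every agent in `Λ` loses at most
the value of one fractionally held item. -/
theorem exists_rounding {α β : Type*} [Fintype α] [DecidableEq α] [Fintype β] [DecidableEq β]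
    (c v : α → β → ℝ) (b : α → ℝ) (hv : ∀ i j, 0 ≤ v i j) (hb : ∀ i, 0 ≤ b i)
    (Λ : Finset α) (x : α → β → ℝ) (hx0 : ∀ i j, 0 ≤ x i j) (hx1 : ∀ j, ∑ i, x i j = 1)
    (hbound : ∀ i ∈ Λ, ∀ j, 0 < x i j → x i j < 1 → v i j ≤ b i) :
    ∃ g : β → α, (∀ j, 0 < x (g j) j) ∧
      ∑ j, ∑ i, x i j * c i j ≤ ∑ j, c (g j) j ∧
      ∀ i ∈ Λ, ∑ j, x i j * v i j - b i ≤ ∑ j, if g j = i then v i j else 0 := by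
  classical
  induction hN : (Finset.univ.filter fun e : α × β => 0 < x e.1 e.2 ∧ x e.1 e.2 < 1).card + Λ.card
    using Nat.strong_induction_on generalizing x Λ with
  | _ N ih =>
  subst hN
  set E := Finset.univ.filter fun e : α × β => 0 < x e.1 e.2 ∧ x e.1 e.2 < 1 with hE
  have hle1 : ∀ i j, x i j ≤ 1 := fun i j => by
    rw [← hx1 j]
    exact Finset.single_le_sum (f := fun i => x i j) (fun i _ => hx0 i j) (Finset.mem_univ i)
  have hzero : ∀ i k j, x i j = 1 → k ≠ i → x k j = 0 := fun i k j hi hki => by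
    have h1 := hx1 j
    rw [← Finset.add_sum_erase _ _ (Finset.mem_univ i), hi] at h1
    have h2 : ∑ l ∈ Finset.univ.erase i, x l j = 0 := by linarith
    exact (Finset.sum_eq_zero_iff_of_nonneg fun l _ => hx0 l j).1 h2 k
      (Finset.mem_erase.2 ⟨hki, Finset.mem_univ _⟩)
  have hsupp : ∀ j, ∃ i, 0 < x i j := fun j => by
    by_contra! h
    have : ∑ i, x i j ≤ 0 := Finset.sum_nonpos fun i _ => h i
    rw [hx1] at this
    linarith
  have htri : ∀ i j, x i j = 0 ∨ x i j = 1 ∨ (i, j) ∈ E := fun i j => by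
    rcases (hx0 i j).eq_or_lt with h | h
    · exact Or.inl h.symm
    rcases (hle1 i j).eq_or_lt with h' | h'
    · exact Or.inr (Or.inl h')
    · exact Or.inr (Or.inr (by simp [hE, h, h']))
  by_cases hEe : E = ∅
  · choose g hg using hsupp
    have hg1 : ∀ j, x (g j) j = 1 := fun j => by
      rcases htri (g j) j with h | h | h
      · exact absurd h (hg j).ne'
      · exact h
      · simp [hEe] at h
    have hx : ∀ i j, x i j = if g j = i then 1 else 0 := fun i j => by
      split_ifs with h
      · rw [← h, hg1]
      · exact hzero _ _ _ (hg1 j) (Ne.symm h)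
    refine ⟨g, hg, ?_, fun i _ => ?_⟩
    · simp [hx]
    · simp only [hx, ite_mul, one_mul, zero_mul]
      linarith [hb i]
  by_cases hdrop : ∃ i ∈ Λ, ∑ j, (if (i, j) ∈ E then x i j else 0) ≤ 1
  · obtain ⟨i, hi, hi1⟩ := hdrop
    obtain ⟨g, hg, hgc, hgv⟩ := ih _ (by
      have := Finset.card_erase_lt_of_mem hi
      exact Nat.add_lt_add_left this _) (Λ.erase i) x hx0 hx1
      (fun k hk => hbound k (Finset.mem_of_mem_erase hk)) rfl
    refine ⟨g, hg, hgc, fun k hk => ?_⟩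
    by_cases hki : k = i
    · subst hki
      have h1 : ∑ j, x k j * v k j ≤
          ∑ j, ((if g j = k then v k j else 0) + b k * if (k, j) ∈ E then x k j else 0) := by
        refine Finset.sum_le_sum fun j _ => ?_
        rcases htri k j with h | h | h
        · rw [h]
          have := hv k j
          have := hb k
          split_ifs <;> simp <;> positivity
        · have hgj : g j = k := by
            by_contra hne
            exact (hg j).ne' (hzero _ _ _ h hne)
          have hnE : (k, j) ∉ E := by simp [hE, h]
          simp [h, hgj, hnE]
        · have hmem := (Finset.mem_filter.1 h).2
          have h2 := mul_le_mul_of_nonneg_left (hbound k hi j hmem.1 hmem.2) (hx0 k j)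
          have := hv k j
          rw [if_pos h]
          split_ifs <;> nlinarith
      rw [Finset.sum_add_distrib, ← Finset.mul_sum] at h1
      have := mul_le_mul_of_nonneg_left hi1 (hb k)
      linarith
    · exact hgv k (Finset.mem_erase.2 ⟨hki, hk⟩)
  push Not at hdrop
  let B := E.image Prod.snd
  have hBmem : ∀ j ∈ B, ∀ i, x i j = if (i, j) ∈ E then x i j else 0 := by
    intro j hj i
    split_ifs with h
    · rfl
    rcases htri i j with h0 | h1 | h2
    · exact h0
    · obtain ⟨⟨k, j'⟩, hk, rfl⟩ := Finset.mem_image.1 hj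
      have hk' := (Finset.mem_filter.1 hk).2
      by_cases hki : k = i
      · subst hki; exact absurd hk h
      · exact absurd (hzero i k j' h1 hki) hk'.1.ne'
    · exact absurd h2 h
  have hsumE : ∀ j ∈ B, ∑ i, (if (i, j) ∈ E then x i j else 0) = 1 := fun j hj => by
    rw [← hx1 j]
    exact Finset.sum_congr rfl fun i _ => (hBmem j hj i).symm
  have hcardB : ∑ j, ∑ i, (if (i, j) ∈ E then x i j else 0) = B.card := by
    rw [← Finset.sum_subset (Finset.subset_univ B), Finset.sum_congr rfl hsumE]
    · simp
    · intro j _ hj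
      refine Finset.sum_eq_zero fun i _ => if_neg fun h => hj (Finset.mem_image_of_mem Prod.snd h)
  have hΛB : Λ.card < B.card := by
    rcases Λ.eq_empty_or_nonempty with rfl | hΛ
    · rw [Finset.card_empty, Finset.card_pos]
      exact (Finset.nonempty_iff_ne_empty.2 hEe).image _
    · have h1 : (Λ.card : ℝ) < ∑ i ∈ Λ, ∑ j, (if (i, j) ∈ E then x i j else 0) := by
        rw [Finset.cast_card]
        exact Finset.sum_lt_sum_of_nonempty hΛ hdrop
      have h2 : ∑ i ∈ Λ, ∑ j, (if (i, j) ∈ E then x i j else 0) ≤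
          ∑ i, ∑ j, (if (i, j) ∈ E then x i j else 0) :=
        Finset.sum_le_sum_of_subset_of_nonneg (Finset.subset_univ _) fun i _ _ =>
          Finset.sum_nonneg fun j _ => by split_ifs <;> [exact hx0 i j; exact le_rfl]
      have h3 : ∑ i, ∑ j, (if (i, j) ∈ E then x i j else 0) = B.card := by
        rw [Finset.sum_comm, hcardB]
      rw [h3] at h2
      exact_mod_cast h1.trans_le h2
  have hEB : 2 * B.card ≤ E.card := by
    refine Finset.mul_card_image_le_card_of_maps_to (f := Prod.snd)
      (fun e he => Finset.mem_image_of_mem _ he) 2 fun j hj => ?_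
    by_contra! hlt
    obtain ⟨⟨k, j'⟩, hk, rfl⟩ := Finset.mem_image.1 hj
    have hk' := (Finset.mem_filter.1 hk).2
    have honly : ∀ i, i ≠ k → (if (i, j') ∈ E then x i j' else 0) = 0 := by
      intro i hik
      refine if_neg fun hiE => ?_
      have : ({(i, j'), (k, j')} : Finset (α × β)) ⊆ E.filter fun e => e.2 = j' := by
        intro e he
        simp only [Finset.mem_insert, Finset.mem_singleton] at he
        rcases he with rfl | rfl <;> simp [hiE, hk]
      have := Finset.card_le_card this
      rw [Finset.card_pair (by simpa using hik)] at this
      exact absurd hlt (not_lt.2 this)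
    have := hsumE j' hj
    rw [Finset.sum_eq_single_of_mem k (Finset.mem_univ _) fun i _ hik => honly i hik,
      if_pos hk] at this
    exact hk'.2.ne this
  obtain ⟨d, hd0, hdE, hdB, hdΛ⟩ : ∃ d : α → β → ℝ, (∃ i j, d i j ≠ 0) ∧
      (∀ i j, (i, j) ∉ E → d i j = 0) ∧ (∀ j, ∑ i, d i j = 0) ∧
      ∀ i ∈ Λ, ∑ j, d i j * v i j = 0 := by
    let ext : (E → ℝ) →ₗ[ℝ] (α → β → ℝ) :=
      { toFun := fun d i j => if h : (i, j) ∈ E then d ⟨(i, j), h⟩ else 0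
        map_add' := fun d d' => by ext i j; simp only [Pi.add_apply]; split_ifs <;> simp
        map_smul' := fun r d => by
          ext i j; simp only [Pi.smul_apply, RingHom.id_apply]; split_ifs <;> simp }
    let T : (α → β → ℝ) →ₗ[ℝ] ((B → ℝ) × (Λ → ℝ)) :=
      { toFun := fun d => (fun j => ∑ i, d i j, fun i => ∑ j, d i j * v i j)
        map_add' := fun d d' => by
          ext <;> simp [Finset.sum_add_distrib, add_mul]
        map_smul' := fun r d => by
          ext <;> simp [Finset.mul_sum, mul_assoc] }
    have hker := LinearMap.ker_ne_bot_of_finrank_lt (f := T ∘ₗ ext) (by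
      simp; omega)
    obtain ⟨d, hd, hdne⟩ := (Submodule.ne_bot_iff _).1 hker
    have hT : T (ext d) = 0 := hd
    have hout : ∀ i j, (i, j) ∉ E → ext d i j = 0 := fun i j h => dif_neg h
    refine ⟨ext d, ?_, hout, fun j => ?_, fun i hi => ?_⟩
    · by_contra! h
      refine hdne (funext fun e => ?_)
      have := h e.1.1 e.1.2
      simpa [ext] using this
    · by_cases hj : j ∈ B
      · exact congrFun (congrArg Prod.fst hT) ⟨j, hj⟩
      · exact Finset.sum_eq_zero fun i _ =>
          hout i j fun h => hj (Finset.mem_image_of_mem Prod.snd h)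
    · exact congrFun (congrArg Prod.snd hT) ⟨i, hi⟩
  wlog hdc : 0 ≤ ∑ j, ∑ i, d i j * c i j generalizing d
  · refine this (fun i j => - d i j) (by simpa using hd0) (by simpa using hdE)
      (by simpa using hdB) (by simpa using hdΛ) ?_
    simp only [neg_mul, Finset.sum_neg_distrib]
    linarith
  have hneg : (Finset.univ.filter fun e : α × β => d e.1 e.2 < 0).Nonempty := by
    obtain ⟨i, j, hij⟩ := hd0
    obtain ⟨k, -, hk⟩ := Finset.exists_pos_of_sum_zero_of_exists_nonzero (s := Finset.univ)
      (fun i => -d i j) (by simpa using hdB j) ⟨i, Finset.mem_univ _, by simpa using hij⟩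
    exact ⟨(k, j), by simpa using hk⟩
  obtain ⟨e₀, he₀, hmin⟩ := Finset.exists_min_image _
    (fun e : α × β => x e.1 e.2 / -d e.1 e.2) hneg
  have hd₀ : d e₀.1 e₀.2 < 0 := (Finset.mem_filter.1 he₀).2
  have he₀E : e₀ ∈ E := by
    by_contra h
    exact hd₀.ne (hdE _ _ h)
  set τ := x e₀.1 e₀.2 / -d e₀.1 e₀.2 with hτ
  have hτ0 : 0 ≤ τ := div_nonneg (hx0 _ _) (by linarith)
  have hy0 : ∀ i j, 0 ≤ x i j + τ * d i j := fun i j => by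
    by_cases hij : d i j < 0
    · have := hmin (i, j) (by simpa using hij)
      rw [le_div_iff₀ (by simpa using hij)] at this
      simp only at this
      linarith
    · have := mul_nonneg hτ0 (not_lt.1 hij)
      linarith [hx0 i j]
  have hy1 : ∀ j, ∑ i, (x i j + τ * d i j) = 1 := fun j => by
    rw [Finset.sum_add_distrib, ← Finset.mul_sum, hdB, hx1]; simp
  have hyE : ∀ i j, 0 < x i j + τ * d i j → x i j + τ * d i j < 1 → (i, j) ∈ E := by
    intro i j h0 h1
    by_contra h
    rw [hdE _ _ h, mul_zero, add_zero] at h0 h1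
    exact h (by simp [hE, h0, h1])
  have hlt : (Finset.univ.filter fun e : α × β =>
      0 < x e.1 e.2 + τ * d e.1 e.2 ∧ x e.1 e.2 + τ * d e.1 e.2 < 1).card < E.card := by
    refine Finset.card_lt_card (Finset.ssubset_iff_of_subset ?_ |>.2 ⟨e₀, he₀E, ?_⟩)
    · intro e he
      have := (Finset.mem_filter.1 he).2
      exact hyE e.1 e.2 this.1 this.2
    · have : x e₀.1 e₀.2 + τ * d e₀.1 e₀.2 = 0 := by
        rw [hτ, div_neg, neg_mul, div_mul_cancel₀ _ hd₀.ne]; ring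
      simp [this]
  obtain ⟨g, hg, hgc, hgv⟩ := ih _ (Nat.add_lt_add_right hlt _) Λ
    (fun i j => x i j + τ * d i j) hy0 hy1
    (fun i hi j h0 h1 => by
      have := (Finset.mem_filter.1 (hyE i j h0 h1)).2
      exact hbound i hi j this.1 this.2) rfl
  refine ⟨g, fun j => ?_, ?_, fun i hi => ?_⟩
  · refine (hx0 _ _).lt_of_ne fun h => ?_
    have h1 : (g j, j) ∉ E := by simp [hE, ← h]
    have := hg j
    rw [hdE _ _ h1, ← h] at this
    simp at this
  · refine le_trans ?_ hgc
    simp only [add_mul, Finset.sum_add_distrib, mul_assoc, ← Finset.mul_sum]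
    have := mul_nonneg hτ0 hdc
    linarith
  · refine le_trans (le_of_eq ?_) (hgv i hi)
    simp only [add_mul, Finset.sum_add_distrib, mul_assoc, ← Finset.mul_sum, hdΛ i hi]
    ring

/-- A matching in the graph `P` can be extended greedily, cheapest edge first, until no edge of `P`
joins an unmatched agent to an unmatched item. Unmatched agents, and the agent with the dearest
matched edge, then pay at least as much as the owner for every matched item they are joined to. -/
theorem exists_greedy_matching {α β : Type*} [Fintype α] [DecidableEq α] [Finite β]
    (P : α → β → Prop) (r : α → β → ℝ) (hr : ∀ i j, 0 ≤ r i j) (F₀ : Finset α) (f₀ : α → β)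
    (hinj : Set.InjOn f₀ F₀) (hP : ∀ s ∈ F₀, P s (f₀ s)) (hr0 : ∀ s ∈ F₀, r s (f₀ s) = 0) :
    ∃ (F : Finset α) (f : α → β), F₀ ⊆ F ∧ (∀ s ∈ F₀, f s = f₀ s) ∧ Set.InjOn f F ∧
      (∀ s ∈ F, P s (f s)) ∧ (∀ i ∉ F, ∀ j, P i j → ∃ s ∈ F, f s = j) ∧
      (∀ i ∉ F, ∀ s ∈ F, P i (f s) → r s (f s) ≤ r i (f s)) ∧
      ((∀ s ∈ F, r s (f s) = 0) ∨ ∃ k ∈ F, ∀ s ∈ F, r s (f s) ≤ r k (f k) ∧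
        (P k (f s) → r s (f s) ≤ r k (f s))) := by
  classical
  have key : ∀ (N : ℕ) (F : Finset α) (f : α → β), Fᶜ.card = N → F₀ ⊆ F →
      (∀ s ∈ F₀, f s = f₀ s) → Set.InjOn f F → (∀ s ∈ F, P s (f s)) →
      (∀ i ∉ F, ∀ s ∈ F, P i (f s) → r s (f s) ≤ r i (f s)) →
      (∀ i ∉ F, ∀ j, P i j → (∀ s ∈ F, f s ≠ j) → ∀ s ∈ F, r s (f s) ≤ r i j) →
      ((∀ s ∈ F, r s (f s) = 0) ∨ ∃ k ∈ F, ∀ s ∈ F, r s (f s) ≤ r k (f k) ∧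
        (P k (f s) → r s (f s) ≤ r k (f s))) →
      ∃ (F : Finset α) (f : α → β), F₀ ⊆ F ∧ (∀ s ∈ F₀, f s = f₀ s) ∧ Set.InjOn f F ∧
        (∀ s ∈ F, P s (f s)) ∧ (∀ i ∉ F, ∀ j, P i j → ∃ s ∈ F, f s = j) ∧
        (∀ i ∉ F, ∀ s ∈ F, P i (f s) → r s (f s) ≤ r i (f s)) ∧
        ((∀ s ∈ F, r s (f s) = 0) ∨ ∃ k ∈ F, ∀ s ∈ F, r s (f s) ≤ r k (f k) ∧
          (P k (f s) → r s (f s) ≤ r k (f s))) := by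
    intro N
    induction N using Nat.strong_induction_on with
    | _ N ih =>
    intro F f hN hF hf hfi hfP hc hm hk
    by_cases hdone : ∀ i ∉ F, ∀ j, P i j → ∃ s ∈ F, f s = j
    · exact ⟨F, f, hF, hf, hfi, hfP, hdone, hc, hk⟩
    have hne : {e : α × β | e.1 ∉ F ∧ P e.1 e.2 ∧ ∀ s ∈ F, f s ≠ e.2}.Nonempty := by
      push Not at hdone
      obtain ⟨i, hi, j, hij, hj⟩ := hdone
      exact ⟨(i, j), hi, hij, hj⟩
    obtain ⟨⟨i₀, j₀⟩, ⟨hi₀, hij₀, hj₀⟩, hmin⟩ :=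
      Set.exists_min_image _ (fun e : α × β => r e.1 e.2) (Set.toFinite _) hne
    simp only at hi₀ hij₀ hj₀
    have hmin' : ∀ i ∉ F, ∀ j, P i j → (∀ s ∈ F, f s ≠ j) → r i₀ j₀ ≤ r i j :=
      fun i hi j hij hj => hmin (i, j) ⟨hi, hij, hj⟩
    have hfu : ∀ s ∈ F, Function.update f i₀ j₀ s = f s := fun s hs =>
      Function.update_of_ne (fun h : s = i₀ => hi₀ (h ▸ hs)) _ _
    have hfu₀ : Function.update f i₀ j₀ i₀ = j₀ := Function.update_self _ _ _
    refine ih _ ?_ (insert i₀ F) (Function.update f i₀ j₀) rfl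
      (hF.trans (Finset.subset_insert _ _)) (fun s hs => ?_) ?_ ?_ ?_ ?_ (Or.inr ?_)
    · rw [← hN]
      refine Finset.card_lt_card (Finset.compl_ssubset_compl.2 (Finset.ssubset_insert hi₀))
    · rw [hfu s (hF hs), hf s hs]
    · rw [Finset.coe_insert, Set.injOn_insert (by simpa using hi₀), hfu₀]
      refine ⟨fun a ha b hb h => ?_, ?_⟩
      · rw [hfu a ha, hfu b hb] at h
        exact hfi ha hb h
      · rintro ⟨s, hs, h⟩
        rw [hfu s hs] at h
        exact hj₀ s hs h
    · simp only [Finset.forall_mem_insert, hfu₀]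
      exact ⟨hij₀, fun s hs => by rw [hfu s hs]; exact hfP s hs⟩
    · intro i hi
      simp only [Finset.mem_insert, not_or] at hi
      simp only [Finset.forall_mem_insert, hfu₀]
      exact ⟨fun h => hmin' i hi.2 _ h hj₀, fun s hs => by rw [hfu s hs]; exact hc i hi.2 s hs⟩
    · intro i hi j hij
      simp only [Finset.mem_insert, not_or] at hi
      simp only [Finset.forall_mem_insert, hfu₀]
      rintro ⟨-, hj⟩
      have hj' : ∀ s ∈ F, f s ≠ j := fun s hs => by rw [← hfu s hs]; exact hj s hs
      exact ⟨hmin' i hi.2 j hij hj', fun s hs => by rw [hfu s hs]; exact hm i hi.2 j hij hj' s hs⟩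
    · refine ⟨i₀, Finset.mem_insert_self _ _, ?_⟩
      simp only [Finset.forall_mem_insert, hfu₀]
      exact ⟨⟨le_rfl, fun _ => le_rfl⟩, fun s hs => by
        rw [hfu s hs]; exact ⟨hm i₀ hi₀ j₀ hij₀ hj₀ s hs, hc i₀ hi₀ s hs⟩⟩
  exact key _ F₀ f₀ rfl subset_rfl (fun _ _ => rfl) hinj hP
    (fun i _ s hs _ => by rw [hr0 s hs]; exact hr _ _)
    (fun i _ j _ _ s hs => by rw [hr0 s hs]; exact hr _ _) (Or.inl hr0)

/-- The share of the unmatched items left over after every unmatched agent `i` takes the fraction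
`t i / U i` of them is worth, to some agent, the total regret of the matched agents. -/
theorem exists_sum_regret_le {α : Type*} [Fintype α] [DecidableEq α] [Nonempty α]
    (t w U : α → ℝ) (u : α → α → ℝ) (F : Finset α) (ht : ∀ i, 0 ≤ t i) (hw : ∀ i, 0 ≤ w i)
    (hut : ∀ i, ∀ s ∈ F, u i s ≤ t i)
    (hU : ∀ i, U i = ((Fᶜ).card : ℝ) * t i + ∑ s ∈ F, (t i - u i s))
    (hF : ∀ s ∈ F, t s / 2 ≤ u s s)
    (hc : ∀ i ∉ F, ∀ s ∈ F, t i / 2 ≤ u i s → w s * (t s - u s s) ≤ w i * (t i - u i s))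
    (hk : (∀ s ∈ F, w s * (t s - u s s) = 0) ∨ ∃ k ∈ F, ∀ s ∈ F,
      w s * (t s - u s s) ≤ w k * (t k - u k k) ∧
        (t k / 2 ≤ u k s → w s * (t s - u s s) ≤ w k * (t k - u k s))) :
    ∑ i ∈ Fᶜ, t i / U i ≤ 1 ∧
      ∃ k, ∑ s ∈ F, w s * (t s - u s s) ≤ (1 - ∑ i ∈ Fᶜ, t i / U i) * (w k * U k) := by
  set l : ℝ := ((Fᶜ).card : ℝ) with hl
  have hl0 : 0 ≤ l := Nat.cast_nonneg _
  have hD0 : ∀ i, 0 ≤ ∑ s ∈ F, (t i - u i s) := fun i =>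
    Finset.sum_nonneg fun s hs => sub_nonneg.2 (hut i s hs)
  have hU0 : ∀ i, 0 ≤ U i := fun i => by
    rw [hU]; exact add_nonneg (mul_nonneg hl0 (ht i)) (hD0 i)
  have hly : ∀ i, l * (t i / U i) ≤ 1 := fun i => by
    rw [← mul_div_assoc]
    refine div_le_one_of_le₀ ?_ (hU0 i)
    rw [hU]; linarith [hD0 i]
  have hsum : ∑ i ∈ Fᶜ, t i / U i ≤ 1 := by
    rcases hl0.eq_or_lt with h | h
    · have : Fᶜ = ∅ := by rw [← Finset.card_eq_zero]; exact_mod_cast (h.trans hl).symm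
      simp [this]
    · have : l * ∑ i ∈ Fᶜ, t i / U i ≤ l * 1 := by
        rw [Finset.mul_sum]
        exact (Finset.sum_le_sum fun i _ => hly i).trans_eq (by simp [hl])
      exact le_of_mul_le_mul_left this h
  refine ⟨hsum, ?_⟩
  rcases hk with hk | ⟨k, hkF, hk⟩
  · refine ⟨Classical.arbitrary α, ?_⟩
    rw [Finset.sum_eq_zero hk]
    exact mul_nonneg (sub_nonneg.2 hsum) (mul_nonneg (hw _) (hU0 _))
  obtain ⟨m, hm⟩ := Finite.exists_max fun i => w i * U i
  refine ⟨m, ?_⟩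
  set P := ∑ s ∈ F, w s * (t s - u s s) with hP
  set ρ := w k * (t k - u k k) with hρ
  have hρ0 : 0 ≤ ρ := mul_nonneg (hw k) (sub_nonneg.2 (hut k k hkF))
  have hP0 : 0 ≤ P := Finset.sum_nonneg fun s hs =>
    mul_nonneg (hw s) (sub_nonneg.2 (hut s s hs))
  have hτ : 2 * ρ ≤ w k * t k := by
    have := mul_le_mul_of_nonneg_left (hF k hkF) (hw k)
    rw [hρ]; linarith
  have hPD : ∀ i, 2 * ρ ≤ w i * t i →
      (∀ s ∈ F, t i / 2 ≤ u i s → w s * (t s - u s s) ≤ w i * (t i - u i s)) →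
      P ≤ w i * ∑ s ∈ F, (t i - u i s) := by
    intro i hi hci
    rw [Finset.mul_sum]
    refine Finset.sum_le_sum fun s hs => ?_
    rcases le_total (t i / 2) (u i s) with h | h
    · exact hci s hs h
    · have := mul_le_mul_of_nonneg_left h (hw i)
      have := (hk s hs).1
      linarith
  have hkU : 2 * l * ρ + P ≤ w k * U k := by
    have h1 := hPD k hτ fun s hs => (hk s hs).2
    have h2 := mul_le_mul_of_nonneg_left hτ hl0
    rw [hU]
    linarith
  have hMk := hkU.trans (hm k)
  have hPM : P ≤ w m * U m := by
    have := mul_nonneg hl0 hρ0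
    linarith
  have hM0 := hP0.trans hPM
  have hi : ∀ i ∈ Fᶜ, P ≤ (1 - l * (t i / U i)) * (w m * U m) := by
    intro i hi
    rw [Finset.mem_compl] at hi
    rcases (hU0 i).eq_or_lt with h0 | h0
    · simpa [← h0] using hPM
    have hDU : U i * (1 - l * (t i / U i)) = ∑ s ∈ F, (t i - u i s) := by
      have : U i * (l * (t i / U i)) = l * t i := by field_simp
      rw [mul_sub, this, hU]; ring
    have hly0 : 0 ≤ 1 - l * (t i / U i) := sub_nonneg.2 (hly i)
    rcases le_total (2 * ρ) (w i * t i) with h | h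
    · have h1 := hPD i h (hc i hi)
      rw [← hDU] at h1
      have := mul_le_mul_of_nonneg_left (hm i) hly0
      linarith
    · refine le_trans ?_ (mul_le_mul_of_nonneg_left hMk hly0)
      refine le_of_mul_le_mul_left ?_ h0
      rw [← mul_assoc, hDU, hU]
      have : P * t i ≤ (∑ s ∈ F, (t i - u i s)) * (2 * ρ) := by
        rw [hP, Finset.sum_mul, Finset.sum_mul]
        refine Finset.sum_le_sum fun s hs => ?_
        rcases le_total (t i / 2) (u i s) with h' | h'
        · have h1 := mul_le_mul_of_nonneg_right (hc i hi s hs h') (ht i)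
          have h2 := mul_le_mul_of_nonneg_left h (sub_nonneg.2 (hut i s hs))
          linarith
        · have h1 := mul_le_mul_of_nonneg_right (hk s hs).1 (ht i)
          have h2 := mul_le_mul_of_nonneg_left h' hρ0
          linarith
      have := mul_le_mul_of_nonneg_left this hl0
      linarith
  rcases hl0.eq_or_lt with h | h
  · have : Fᶜ = ∅ := by rw [← Finset.card_eq_zero]; exact_mod_cast (h.trans hl).symm
    simpa [this] using hPM
  · refine le_of_mul_le_mul_left ?_ h
    have h1 := Finset.sum_le_sum hi
    rw [← Finset.sum_mul, Finset.sum_sub_distrib, ← Finset.mul_sum, Finset.sum_const,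
      Finset.sum_const, nsmul_eq_mul, nsmul_eq_mul, ← hl] at h1
    linarith

/-- For all nonnegative weights some allocation has at least the proportional weighted welfare and
gives every agent half her truncated proportional share. -/
theorem exists_half_tps_weighted_proportional {ι : Type*} [Fintype ι] [DecidableEq ι] [Nonempty ι]
    {n : ℕ} (hn : 1 ≤ n) (v : Fin n → ι → ℝ) (hv : ∀ i j, 0 ≤ v i j) (t : Fin n → ℝ)
    (htps : ∀ i, isTPS n Finset.univ (v i) (t i)) (w : Fin n → ℝ) (hw : ∀ i, 0 ≤ w i) :
    ∃ g : ι → Fin n, (∀ i, t i / 2 ≤ ∑ j, if g j = i then v i j else 0) ∧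
      (∑ i, w i * ∑ j, v i j) / n ≤ ∑ j, w (g j) * v (g j) j := by
  have : Nonempty (Fin n) := ⟨⟨0, hn⟩⟩
  have hn0 : (0 : ℝ) < n := by exact_mod_cast hn
  have ht : ∀ i, 0 ≤ t i := fun i => (htps i).1.1
  obtain ⟨F₀, f₀, hinj₀, hS₀, hw₀⟩ := exists_matching_weight_ge hn
    (fun i => Finset.univ.filter fun j => t i < v i j) (fun i => (htps i).card_lt_le hn)
    (fun i j => w i * (v i j - t i))
  have hS₀' : ∀ s ∈ F₀, t s < v s (f₀ s) := fun s hs => (Finset.mem_filter.1 (hS₀ s hs)).2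
  obtain ⟨F, f, hF₀, hf₀, hfi, hfP, hfL, hc, hk⟩ := exists_greedy_matching
    (fun i j => t i / 2 ≤ v i j) (fun i j => w i * (t i - min (v i j) (t i)))
    (fun i j => mul_nonneg (hw i) (sub_nonneg.2 (min_le_right _ _))) F₀ f₀ hinj₀
    (fun s hs => by linarith [hS₀' s hs, ht s])
    (fun s hs => by simp only [min_eq_right (hS₀' s hs).le, sub_self, mul_zero])
  let J := F.image f
  let U : Fin n → ℝ := fun i => ∑ j ∈ Jᶜ, min (v i j) (t i)
  have hU : ∀ i, U i = ((Fᶜ).card : ℝ) * t i + ∑ s ∈ F, (t i - min (v i (f s)) (t i)) := by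
    intro i
    have h1 := (htps i).sum_min_eq hn
    rw [← Finset.sum_add_sum_compl J, Finset.sum_image hfi] at h1
    have h2 : ((Fᶜ).card : ℝ) = n - F.card := by
      rw [Finset.card_compl, Fintype.card_fin, Nat.cast_sub (by simpa using F.card_le_univ)]
    rw [Finset.sum_sub_distrib, Finset.sum_const, nsmul_eq_mul, h2]
    linarith
  obtain ⟨hsum, k, hk⟩ := exists_sum_regret_le t w U (fun i s => min (v i (f s)) (t i)) F ht hw
    (fun i s _ => min_le_right _ _) hU
    (fun s hs => le_min (hfP s hs) (by linarith [ht s]))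
    (fun i hi s hs h => hc i hi s hs (h.trans (min_le_left _ _)))
    (hk.imp id fun ⟨k, hkF, hk⟩ => ⟨k, hkF, fun s hs =>
      ⟨(hk s hs).1, fun h => (hk s hs).2 (h.trans (min_le_left _ _))⟩⟩)
  have hUv : ∀ i, U i ≤ ∑ j ∈ Jᶜ, v i j := fun i =>
    Finset.sum_le_sum fun j _ => min_le_left _ _
  have hU0 : ∀ i, 0 ≤ U i := fun i => Finset.sum_nonneg fun j _ => le_min (hv i j) (ht i)
  have htU : ∀ i ∈ Fᶜ, t i / U i * U i = t i := by
    intro i hi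
    refine div_mul_cancel_of_imp fun h0 => ?_
    have hcard : (1 : ℝ) ≤ (Fᶜ).card := by exact_mod_cast Finset.card_pos.2 ⟨i, hi⟩
    have h1 : 0 ≤ ∑ s ∈ F, (t i - min (v i (f s)) (t i)) :=
      Finset.sum_nonneg fun s _ => sub_nonneg.2 (min_le_right _ _)
    have h2 := hU i
    nlinarith [ht i]
  let y : Fin n → ℝ := fun i => (if i ∈ Fᶜ then t i / U i else 0) +
    if i = k then 1 - ∑ i ∈ Fᶜ, t i / U i else 0
  have hyt : ∀ i ∈ Fᶜ, t i / U i ≤ y i := fun i hi => by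
    simp only [y, if_pos hi]
    split_ifs <;> linarith
  have hy0 : ∀ i, 0 ≤ y i := fun i => by
    have := div_nonneg (ht i) (hU0 i)
    refine add_nonneg ?_ ?_ <;> split_ifs <;> linarith
  have hy1 : ∑ i, y i = 1 := by
    simp only [y]
    rw [Finset.sum_add_distrib, Finset.sum_ite_eq' Finset.univ k, if_pos (Finset.mem_univ k),
      Finset.sum_ite_mem, Finset.univ_inter]
    ring
  have hyU : ∑ i, y i * (w i * U i) =
      ∑ i ∈ Fᶜ, w i * t i + (1 - ∑ i ∈ Fᶜ, t i / U i) * (w k * U k) := by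
    simp only [y, add_mul, ite_mul, zero_mul]
    rw [Finset.sum_add_distrib, Finset.sum_ite_eq' Finset.univ k, if_pos (Finset.mem_univ k),
      Finset.sum_ite_mem, Finset.univ_inter]
    congr 1
    refine Finset.sum_congr rfl fun i hi => ?_
    rw [mul_left_comm, htU i hi]
  let x : Fin n → ι → ℝ := fun i j =>
    if j ∈ J then (if i ∈ F ∧ f i = j then 1 else 0) else y i
  have hxJ : ∀ s ∈ F, ∀ i, x i (f s) = if i = s then 1 else 0 := fun s hs i => by
    refine (if_pos (Finset.mem_image_of_mem f hs)).trans ?_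
    refine if_congr ⟨fun h => hfi h.1 hs h.2, ?_⟩ rfl rfl
    rintro rfl
    exact ⟨hs, rfl⟩
  have hxR : ∀ j ∈ Jᶜ, ∀ i, x i j = y i := fun j hj i => if_neg (Finset.mem_compl.1 hj)
  have hx0 : ∀ i j, 0 ≤ x i j := fun i j => by
    simp only [x]
    split_ifs <;> first | exact hy0 i | simp
  obtain ⟨g, hg, hgc, hgv⟩ := exists_rounding (fun i j => w i * v i j) v (fun i => t i / 2) hv
    (fun i => by linarith [ht i]) Fᶜ x hx0
    (fun j => by
      by_cases hj : j ∈ J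
      · obtain ⟨s, hs, rfl⟩ := Finset.mem_image.1 hj
        simp [hxJ s hs]
      · rw [Finset.sum_congr rfl fun i _ => hxR j (Finset.mem_compl.2 hj) i, hy1])
    (fun i hi j h0 h1 => by
      by_contra! hlt
      obtain ⟨s, hs, rfl⟩ := hfL i (Finset.mem_compl.1 hi) j hlt.le
      rw [hxJ s hs] at h0 h1
      split_ifs at h0 h1 <;> linarith)
  refine ⟨g, fun i => ?_, ?_⟩
  · by_cases hi : i ∈ F
    · have hgi : g (f i) = i := by
        have := hg (f i)
        rw [hxJ i hi] at this
        by_contra hne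
        simp [hne] at this
      have := Finset.single_le_sum (f := fun j => if g j = i then v i j else 0)
        (fun j _ => by split_ifs <;> [exact hv i j; exact le_rfl]) (Finset.mem_univ (f i))
      simp only [if_pos hgi] at this
      exact (hfP i hi).trans this
    · have hi' := Finset.mem_compl.2 hi
      refine le_trans ?_ (hgv i hi')
      have h1 : y i * ∑ j ∈ Jᶜ, v i j ≤ ∑ j, x i j * v i j := by
        rw [Finset.mul_sum]
        refine (Finset.sum_congr rfl fun j hj => by rw [hxR j hj i]).trans_le <|
          Finset.sum_le_sum_of_subset_of_nonneg (f := fun j => x i j * v i j)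
            (Finset.subset_univ Jᶜ) fun j _ _ => mul_nonneg (hx0 i j) (hv i j)
      have h2 := mul_le_mul_of_nonneg_left (hUv i) (hy0 i)
      have h3 := mul_le_mul_of_nonneg_right (hyt i hi') (hU0 i)
      rw [htU i hi'] at h3
      linarith
  · refine le_trans ?_ hgc
    have hJ : ∑ j ∈ J, ∑ i, x i j * (w i * v i j) = ∑ s ∈ F, w s * v s (f s) := by
      rw [Finset.sum_image hfi]
      refine Finset.sum_congr rfl fun s hs => ?_
      simp [hxJ s hs]
    have hR : ∑ i, y i * (w i * U i) ≤ ∑ j ∈ Jᶜ, ∑ i, x i j * (w i * v i j) := by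
      rw [Finset.sum_comm]
      refine Finset.sum_le_sum fun i _ => ?_
      rw [Finset.sum_congr rfl fun j hj => by rw [hxR j hj i], ← Finset.mul_sum, ← Finset.mul_sum]
      exact mul_le_mul_of_nonneg_left (mul_le_mul_of_nonneg_left (hUv i) (hw i)) (hy0 i)
    have hE : ∑ s ∈ F₀, w s * (v s (f₀ s) - t s) ≤
        ∑ s ∈ F, w s * (v s (f s) - min (v s (f s)) (t s)) := by
      refine le_trans (Finset.sum_le_sum fun s hs => ?_)
        (Finset.sum_le_sum_of_subset_of_nonneg hF₀ fun s _ _ =>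
          mul_nonneg (hw s) (sub_nonneg.2 (min_le_left _ _)))
      rw [hf₀ s hs, min_eq_right (hS₀' s hs).le]
    have hV : ∀ i, ∑ j, v i j =
        n * t i + ∑ j ∈ Finset.univ.filter (fun j => t i < v i j), (v i j - t i) := by
      intro i
      rw [← (htps i).sum_min_eq hn, Finset.sum_filter, ← Finset.sum_add_distrib]
      refine Finset.sum_congr rfl fun j _ => ?_
      split_ifs with h
      · rw [min_eq_right h.le]; ring
      · rw [min_eq_left (not_lt.1 h)]; ring
    have hWV : (∑ i, w i * ∑ j, v i j) / n = ∑ i, w i * t i +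
        (∑ i, ∑ j ∈ Finset.univ.filter (fun j => t i < v i j), w i * (v i j - t i)) / n := by
      rw [div_eq_iff hn0.ne', add_mul, div_mul_cancel₀ _ hn0.ne', Finset.sum_mul,
        ← Finset.sum_add_distrib]
      refine Finset.sum_congr rfl fun i _ => ?_
      rw [hV, ← Finset.mul_sum]
      ring
    rw [hWV, ← Finset.sum_add_sum_compl J, hJ]
    have hsplit := Finset.sum_add_sum_compl F fun i => w i * t i
    have hF2 : ∑ s ∈ F, w s * v s (f s) + ∑ s ∈ F, w s * (t s - min (v s (f s)) (t s)) =
        ∑ s ∈ F, w s * t s + ∑ s ∈ F, w s * (v s (f s) - min (v s (f s)) (t s)) := by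
      rw [← Finset.sum_add_distrib, ← Finset.sum_add_distrib]
      exact Finset.sum_congr rfl fun s _ => by ring
    linarith

/-- Every allocation is weakly dominated by a Pareto optimal one. -/
theorem exists_isPO_ge {ι : Type*} [Fintype ι] [DecidableEq ι] {n : ℕ} (v : Fin n → ι → ℝ)
    {A : Fin n → Finset ι} (hA : isAlloc A) :
    ∃ B, isAlloc B ∧ (∀ i, val (v i) (A i) ≤ val (v i) (B i)) ∧ isPO v B := by
  obtain ⟨B, ⟨hB, hAB⟩, hmax⟩ := Set.exists_max_image
    {B : Fin n → Finset ι | isAlloc B ∧ ∀ i, val (v i) (A i) ≤ val (v i) (B i)}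
    (fun B => ∑ i, val (v i) (B i)) (Set.toFinite _) ⟨A, hA, fun _ => le_rfl⟩
  refine ⟨B, hB, hAB, ?_⟩
  rintro ⟨C, hC, hBC, i, hi⟩
  have h := hmax C ⟨hC, fun i => (hAB i).trans (hBC i)⟩
  exact h.not_gt (Finset.sum_lt_sum (fun i _ => hBC i) ⟨i, Finset.mem_univ i, hi⟩)

/-- The fibres of an assignment of items to agents form an allocation. -/
theorem isAlloc_fibers {ι : Type*} [Fintype ι] [DecidableEq ι] {n : ℕ} (g : ι → Fin n) :
    isAlloc fun i => Finset.univ.filter fun j => g j = i := by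
  refine ⟨fun i k hik => Finset.disjoint_left.2 fun j hj hj' => hik ?_, ?_⟩
  · rw [← (Finset.mem_filter.1 hj).2, (Finset.mem_filter.1 hj').2]
  · ext j
    simp

/-- For all nonnegative weights some allocation has at least the proportional weighted welfare and
gives every agent half her truncated proportional share. -/
theorem exists_isAlloc_weighted_proportional {ι : Type*} [Fintype ι] [DecidableEq ι]
    {n : ℕ} (hn : 1 ≤ n) (v : Fin n → ι → ℝ) (hv : ∀ i j, 0 ≤ v i j) (t : Fin n → ℝ)
    (htps : ∀ i, isTPS n Finset.univ (v i) (t i)) (w : Fin n → ℝ) (hw : ∀ i, 0 ≤ w i) :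
    ∃ A : Fin n → Finset ι, isAlloc A ∧ (∀ i, t i / 2 ≤ val (v i) (A i)) ∧
      0 ≤ ∑ i, w i * (val (v i) (A i) - val (v i) Finset.univ / n) := by
  rcases isEmpty_or_nonempty ι with hι | hι
  · refine ⟨fun _ => ∅, ⟨fun i j _ => by simp, Finset.eq_univ_of_forall fun j => hι.elim j⟩,
      fun i => ?_, by simp [_root_.val]⟩
    have := (htps i).1.2
    simp at this
    simp [_root_.val, ← this]
  obtain ⟨g, hg, hgw⟩ := exists_half_tps_weighted_proportional hn v hv t htps w hw
  refine ⟨_, isAlloc_fibers g, fun i => ?_, ?_⟩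
  · simpa only [_root_.val, Finset.sum_filter] using hg i
  · have : ∑ j, w (g j) * v (g j) j =
        ∑ i, w i * ∑ j ∈ Finset.univ.filter (fun j => g j = i), v i j := by
      simp only [Finset.sum_filter, Finset.mul_sum, mul_ite, mul_zero]
      rw [Finset.sum_comm]
      simp
    simp only [_root_.val, mul_sub, Finset.sum_sub_distrib]
    rw [this, Finset.sum_div] at hgw
    simp only [mul_div_assoc] at hgw
    linarith

/-- there is a randomized allocation supported on at most `n`
allocations that is ex-ante proportional, and every allocation in its support
gives every agent at least half her TPS (hence at least half her MMS) and is
Pareto optimal. -/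
theorem stmt8 {ι : Type*} [Fintype ι] [DecidableEq ι] (n : ℕ) (hn : 1 ≤ n)
    (v : Fin n → ι → ℝ) (hv : ∀ i j, 0 ≤ v i j)
    (tps mms : Fin n → ℝ)
    (htps : ∀ i, isTPS n Finset.univ (v i) (tps i))
    (hmms : ∀ i, isMMS n (v i) (mms i)) :
    ∃ (ℓ : ℕ) (A : Fin ℓ → Fin n → Finset ι) (p : Fin ℓ → ℝ),
      ℓ ≤ n ∧
      (∀ k, 0 ≤ p k) ∧ (∑ k, p k = 1) ∧ (∀ k, isAlloc (A k)) ∧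
      (∀ i, (∑ k, p k * val (v i) (A k i)) ≥ val (v i) Finset.univ / n) ∧
      (∀ k, 0 < p k →
        (∀ i, val (v i) (A k i) ≥ (1 / 2) * tps i) ∧
        (∀ i, val (v i) (A k i) ≥ (1 / 2) * mms i) ∧
        isPO v (A k)) := by
  let κ := {A : Fin n → Finset ι // isAlloc A ∧ ∀ i, tps i / 2 ≤ val (v i) (A i)}
  obtain ⟨ℓ, K, p, hℓ, hp0, hp1, hp⟩ := exists_convexCombination_nonneg hn
    (fun (A : κ) i => val (v i) (A.1 i) - val (v i) Finset.univ / n)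
    (convexHull_inter_nonneg_nonempty _ fun w hw => by
      obtain ⟨A, hA, hAt, hAw⟩ := exists_isAlloc_weighted_proportional hn v hv tps htps w hw
      exact ⟨⟨A, hA, hAt⟩, hAw⟩)
  choose B hB hKB hPO using fun k => exists_isPO_ge v (K k).2.1
  have hBt : ∀ k i, tps i / 2 ≤ val (v i) (B k i) := fun k i =>
    ((K k).2.2 i).trans (hKB k i)
  refine ⟨ℓ, B, p, hℓ, hp0, hp1, hB, fun i => ?_, fun k _ => ⟨fun i => ?_, fun i => ?_, hPO k⟩⟩
  · have h := hp i
    simp only [mul_sub, Finset.sum_sub_distrib, ← Finset.sum_mul, hp1, one_mul] at h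
    have h1 : ∑ k, p k * val (v i) ((K k).1 i) ≤ ∑ k, p k * val (v i) (B k i) :=
      Finset.sum_le_sum fun k _ => mul_le_mul_of_nonneg_left (hKB k i) (hp0 k)
    linarith
  · linarith [hBt k i]
  · linarith [hBt k i, (hmms i).le_tps hn (hv i) (htps i)]
end

section
/- Let x = (x_{ij}) be a fractional allocation of m items to n agents with additive valuations, and let f be the number of pairs (i,j) with 0 < x_{ij} < 1. Then there exist at most f+1 allocations A^1,…,A^ℓ and probabilities p_1,…,p_ℓ ≥ 0 summing to 1 such that: (a) for every agent i and item j, Σ_k p_k·1[j ∈ A^k_i] = x_{ij} (the distribution implements x); and (b) for every agent i and any two indices k, k', |v_i(A^k_i) − v_i(A^{k'}_i)| ≤ max{ v_i(j) : 0 < x_{ij} < 1 } (small spread; the maximum taken as 0 if no such item exists). -/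
open Finset

/-- The integers, as an additive subgroup of the reals. -/
def intReals : AddSubgroup ℝ := (Int.castAddHom ℝ).range

theorem one_mem_intReals : (1 : ℝ) ∈ intReals := ⟨1, by simp⟩

theorem intCast_mem_intReals (k : ℤ) : (k : ℝ) ∈ intReals := ⟨k, by simp⟩

theorem eq_zero_or_one_of_mem_intReals {s : ℝ} (hs : s ∈ intReals) (h0 : 0 ≤ s) (h1 : s ≤ 1) :
    s = 0 ∨ s = 1 := by
  obtain ⟨k, rfl⟩ := hs
  simp only [Int.coe_castAddHom] at *
  have h0' : 0 ≤ k := by exact_mod_cast h0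
  have h1' : k ≤ 1 := by exact_mod_cast h1
  obtain rfl | rfl : k = 0 ∨ k = 1 := by omega
  · simp
  · simp

theorem two_mul_card_image_le {E X : Type*} [Fintype E] [DecidableEq X] (c : E → X)
    (hc : ∀ e, ∃ e', e' ≠ e ∧ c e' = c e) : 2 * #(univ.image c) ≤ Fintype.card E := by
  classical
  refine Finset.mul_card_image_le_card univ 2 ?_
  intro x hx
  obtain ⟨e, -, rfl⟩ := Finset.mem_image.1 hx
  obtain ⟨e', hne, he'⟩ := hc e
  exact Finset.one_lt_card.2 ⟨e', by simp [he'], e, by simp, hne⟩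

theorem fiber_sum_eq_zero_of_notMem_image {E X : Type*} [Fintype E] [DecidableEq X] (c : E → X)
    (d : E → ℝ) {x : X} (hx : x ∉ univ.image c) : ∑ e with c e = x, d e = 0 := by
  rw [Finset.filter_false_of_mem, sum_empty]
  intro e _ he
  exact hx (he ▸ mem_image_of_mem c (mem_univ e))

/-- If all fibers of two maps on a finite nonempty type are empty or have at least two elements,
some nonzero function sums to zero over all these fibers. -/
theorem exists_ne_zero_fiber_sums_eq_zero {E U W : Type*} [Fintype E] [Nonempty E]
    [DecidableEq U] [DecidableEq W] (a : E → U) (b : E → W)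
    (ha : ∀ e, ∃ e', e' ≠ e ∧ a e' = a e) (hb : ∀ e, ∃ e', e' ≠ e ∧ b e' = b e) :
    ∃ d : E → ℝ, d ≠ 0 ∧ (∀ u, ∑ e with a e = u, d e = 0) ∧ ∀ w, ∑ e with b e = w, d e = 0 := by
  classical
  have hA := two_mul_card_image_le a ha
  have hB := two_mul_card_image_le b hb
  let L : (E → ℝ) →ₗ[ℝ] ((univ.image a) → ℝ) × ((univ.image b) → ℝ) :=
    { toFun := fun d => (fun u => ∑ e with a e = u, d e, fun w => ∑ e with b e = w, d e)
      map_add' := by intro d d'; ext <;> simp [sum_add_distrib]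
      map_smul' := by intro c d; ext <;> simp [mul_sum] }
  by_cases hL : Function.Injective L
  · exfalso
    have hfin : Module.finrank ℝ (E → ℝ) =
        Module.finrank ℝ (((univ.image a) → ℝ) × ((univ.image b) → ℝ)) := by
      apply le_antisymm (LinearMap.finrank_le_finrank_of_injective hL)
      simp only [Module.finrank_prod, Module.finrank_fintype_fun_eq_card, Fintype.card_coe]
      omega
    obtain ⟨d, hd⟩ := (LinearMap.injective_iff_surjective_of_finrank_eq_finrank hfin).1 hL (1, 0)
    have h1 : ∀ u ∈ univ.image a, ∑ e with a e = u, d e = 1 := fun u hu =>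
      congrFun (congrArg Prod.fst hd) ⟨u, hu⟩
    have h2 : ∀ w ∈ univ.image b, ∑ e with b e = w, d e = 0 := fun w hw =>
      congrFun (congrArg Prod.snd hd) ⟨w, hw⟩
    have h3 := Finset.sum_fiberwise_of_maps_to (s := univ) (t := univ.image a) (g := a)
      (fun e _ => mem_image_of_mem a (mem_univ e)) d
    have h4 := Finset.sum_fiberwise_of_maps_to (s := univ) (t := univ.image b) (g := b)
      (fun e _ => mem_image_of_mem b (mem_univ e)) d
    rw [sum_congr rfl h1] at h3
    rw [sum_congr rfl h2, ← h3] at h4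
    simp only [sum_const_zero, sum_const, nsmul_eq_mul, mul_one] at h4
    have hne : #(univ.image a) = 0 := by exact_mod_cast h4.symm
    simp [Finset.univ_eq_empty_iff] at hne
  · rw [← LinearMap.ker_eq_bot, ← ne_eq, Submodule.ne_bot_iff] at hL
    obtain ⟨d, hd, hd0⟩ := hL
    refine ⟨d, hd0, fun u => ?_, fun w => ?_⟩
    · by_cases hu : u ∈ univ.image a
      · exact congrFun (congrArg Prod.fst hd) ⟨u, hu⟩
      · exact fiber_sum_eq_zero_of_notMem_image a d hu
    · by_cases hw : w ∈ univ.image b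
      · exact congrFun (congrArg Prod.snd hd) ⟨w, hw⟩
      · exact fiber_sum_eq_zero_of_notMem_image b d hw

/-- A fiber with an integral sum does not contain exactly one non-integral entry. -/
theorem exists_ne_notMem_intReals {E X : Type*} [Fintype E] [DecidableEq X] (c : E → X) (y : E → ℝ)
    (hc : ∀ x, ∑ e with c e = x, y e ∈ intReals) (e : {e // y e ∉ intReals}) :
    ∃ e' : {e // y e ∉ intReals}, e' ≠ e ∧ c e' = c e := by
  classical
  by_contra! hno
  apply e.2
  have hmem : (e : E) ∈ univ.filter (fun e' => c e' = c e) := by simp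
  rw [eq_sub_of_add_eq (add_sum_erase _ y hmem)]
  refine sub_mem (hc _) (sum_mem fun e' he' => ?_)
  by_contra hfrac
  simp only [mem_erase, mem_filter, mem_univ, true_and] at he'
  exact hno ⟨e', hfrac⟩ (fun h => he'.1 (congrArg Subtype.val h)) he'.2

/-- If all fiber sums of a real function `y` under two maps are integers, but `y` is not integral,
there is a nonzero direction supported on the non-integral entries of `y` that preserves all fiber
sums. -/
theorem exists_direction_of_fiber_sums_mem_intReals {E U W : Type*} [Fintype E]
    [DecidableEq U] [DecidableEq W] (a : E → U) (b : E → W) (y : E → ℝ)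
    (ha : ∀ u, ∑ e with a e = u, y e ∈ intReals) (hb : ∀ w, ∑ e with b e = w, y e ∈ intReals)
    (hy : ∃ e, y e ∉ intReals) :
    ∃ d : E → ℝ, d ≠ 0 ∧ (∀ e, y e ∈ intReals → d e = 0) ∧
      (∀ u, ∑ e with a e = u, d e = 0) ∧ ∀ w, ∑ e with b e = w, d e = 0 := by
  classical
  have : Nonempty {e // y e ∉ intReals} := let ⟨e, he⟩ := hy; ⟨⟨e, he⟩⟩
  obtain ⟨d, hd0, hda, hdb⟩ := exists_ne_zero_fiber_sums_eq_zero
    (fun e : {e // y e ∉ intReals} => a e) (fun e => b e)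
    (exists_ne_notMem_intReals a y ha) (exists_ne_notMem_intReals b y hb)
  have extend_sum (q : E → Prop) [DecidablePred q] :
      (∑ e with q e, if h : y e ∉ intReals then d ⟨e, h⟩ else 0) =
        ∑ e ∈ univ.filter (fun e : {e // y e ∉ intReals} => q e), d e := by
    rw [sum_filter, sum_filter, ← Fintype.sum_subtype_add_sum_subtype (fun e => y e ∉ intReals)]
    rw [Finset.sum_eq_zero (s := (univ : Finset {e // ¬ y e ∉ intReals})), add_zero]
    · refine sum_congr rfl fun e _ => ?_
      rw [dif_pos e.2]
    · intro e _
      rw [dif_neg e.2, ite_self]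
  refine ⟨fun e => if h : y e ∉ intReals then d ⟨e, h⟩ else 0, ?_, ?_, ?_, ?_⟩
  · contrapose! hd0
    ext e
    simpa [e.2] using congrFun hd0 e
  · intro e he
    simp [he]
  · intro u
    rw [extend_sum, hda]
  · intro w
    rw [extend_sum, hdb]

/-- Abel summation bound: if the sums of `z` over all upper level sets of `w` above `c` are bounded
by one, the sum of `(w - c) * z` is bounded by the range of `w - c`. -/
theorem abs_sum_sub_mul_le {E : Type*} [DecidableEq E] (s : Finset E) (w z : E → ℝ) (M : ℝ)
    (hM : ∀ e ∈ s, w e ≤ M) (c : ℝ) (hcM : c ≤ M) (hc : ∀ e ∈ s, c ≤ w e)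
    (hz : ∀ e' ∈ s, c < w e' → |∑ e ∈ s with w e' ≤ w e, z e| ≤ 1) :
    |∑ e ∈ s, (w e - c) * z e| ≤ M - c := by
  induction s using Finset.induction_on_min_value w generalizing c with
  | empty => simpa using hcM
  | insert e₀ s he₀ hmin ih =>
    have hM₀ := hM e₀ (mem_insert_self _ _)
    have hc₀ := hc e₀ (mem_insert_self _ _)
    have hs := ih (fun e he => hM e (mem_insert_of_mem he)) (w e₀) hM₀ hmin (by
      intro e' he' hlt
      have := hz e' (mem_insert_of_mem he') (hc₀.trans_lt hlt)
      rwa [filter_insert, if_neg hlt.not_ge] at this)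
    have hsplit : ∑ e ∈ insert e₀ s, (w e - c) * z e =
        ∑ e ∈ s, (w e - w e₀) * z e + (w e₀ - c) * ∑ e ∈ insert e₀ s, z e := by
      rw [sum_insert he₀, sum_insert he₀, mul_add, mul_sum, add_left_comm, ← sum_add_distrib]
      congr 1
      exact sum_congr rfl fun e _ => by ring
    have hfirst : |(w e₀ - c) * ∑ e ∈ insert e₀ s, z e| ≤ w e₀ - c := by
      obtain rfl | hlt := hc₀.eq_or_lt
      · simp
      · have := hz e₀ (mem_insert_self _ _) hlt
        rw [filter_true_of_mem (by
          intro e he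
          obtain rfl | he := mem_insert.1 he
          exacts [le_rfl, hmin e he])] at this
        rw [abs_mul, abs_of_pos (sub_pos.2 hlt)]
        exact mul_le_of_le_one_right (sub_pos.2 hlt).le this
    rw [hsplit]
    linarith [abs_add_le (∑ e ∈ s, (w e - w e₀) * z e) ((w e₀ - c) * ∑ e ∈ insert e₀ s, z e)]

theorem eventually_add_mul_mem_Icc {l u : ℤ} {s t : ℝ} (hl : l ≤ s) (hu : s ≤ u)
    (ht : s ∈ intReals → t = 0) :
    ∀ᶠ ε in nhds (0 : ℝ), l ≤ s + ε * t ∧ s + ε * t ≤ u := by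
  by_cases hs : s ∈ intReals
  · simp [ht hs, hl, hu]
  · have hl' : (l : ℝ) < s := lt_of_le_of_ne hl fun h => hs (h ▸ intCast_mem_intReals l)
    have hu' : s < u := lt_of_le_of_ne hu fun h => hs (h ▸ intCast_mem_intReals u)
    have hcont : Filter.Tendsto (fun ε : ℝ => s + ε * t) (nhds 0) (nhds s) := by
      have : Continuous fun ε : ℝ => s + ε * t := by fun_prop
      simpa using this.tendsto 0
    filter_upwards [hcont.eventually_const_lt hl', hcont.eventually_lt_const hu'] with ε h1 h2
    exact ⟨h1.le, h2.le⟩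

/-- The sum of `y` over the edges of the same agent whose weight is at least that of `e'`. -/
noncomputable def upperSum {E I : Type*} [Fintype E] [DecidableEq I] (b : E → I)
    (w y : E → ℝ) (e' : E) : ℝ :=
  ∑ e with b e = b e' ∧ w e' ≤ w e, y e

theorem upperSum_add_smul {E I : Type*} [Fintype E] [DecidableEq I] (b : E → I) (w : E → ℝ)
    (y d : E → ℝ) (ε : ℝ) (e' : E) :
    upperSum b w (y + ε • d) e' = upperSum b w y e' + ε * upperSum b w d e' := by
  simp [upperSum, sum_add_distrib, mul_sum]

/-- A nonintegral vector with integral fiber sums has a nonzero direction that preserves its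
integral entries, its fiber sums and its integral upper sums. -/
theorem exists_direction {E U I : Type*} [Fintype E] [DecidableEq U] [DecidableEq I] [Fintype I]
    (a : E → U) (b : E → I) (w : E → ℝ) (y : E → ℝ)
    (ha : ∀ u, ∑ e with a e = u, y e ∈ intReals) (hy : ∃ e, y e ∉ intReals) :
    ∃ d : E → ℝ, d ≠ 0 ∧ (∀ e, y e ∈ intReals → d e = 0) ∧ (∀ u, ∑ e with a e = u, d e = 0) ∧
      ∀ e, upperSum b w y e ∈ intReals → upperSum b w d e = 0 := by
  classical
  let below (e : E) : Finset E := {e' | upperSum b w y e' ∈ intReals ∧ b e = b e' ∧ w e' ≤ w e}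
  have below_mono {e e' : E} (hb : b e = b e') (hw : w e' ≤ w e) : below e' ⊆ below e := by
    intro f hf
    simp only [below, mem_filter, mem_univ, true_and] at hf ⊢
    exact ⟨hf.1, hb.trans hf.2.1, hf.2.2.trans hw⟩
  let level (e : E) : ℕ := #(below e)
  let block (e : E) : Option (I × ℕ) := if level e = 0 then none else some (b e, level e)
  have cumulative (i : I) (k : ℕ) (hk : 1 ≤ k) :
      ∑ e with b e = i ∧ k ≤ level e, y e ∈ intReals := by
    obtain hempty | hne := (univ.filter fun e => b e = i ∧ k ≤ level e).eq_empty_or_nonempty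
    · rw [hempty, sum_empty]; exact zero_mem _
    obtain ⟨e₀, he₀, hmin⟩ := exists_min_image _ w hne
    simp only [mem_filter, mem_univ, true_and] at he₀ hmin
    obtain ⟨e₁, he₁, hmax⟩ := exists_max_image (below e₀) w (card_pos.1 (hk.trans he₀.2))
    have he₁' := he₁
    simp only [below, mem_filter, mem_univ, true_and] at he₁' hmax
    have hset : (univ.filter fun e => b e = i ∧ k ≤ level e) =
        univ.filter fun e => b e = b e₁ ∧ w e₁ ≤ w e := by
      ext e
      simp only [mem_filter, mem_univ, true_and]
      constructor
      · rintro ⟨hi, hl⟩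
        exact ⟨hi.trans (he₀.1.symm.trans he₁'.2.1), he₁'.2.2.trans (hmin e ⟨hi, hl⟩)⟩
      · rintro ⟨hi, hl⟩
        refine ⟨hi.trans (he₁'.2.1.symm.trans he₀.1), he₀.2.trans (card_le_card ?_)⟩
        intro f hf
        simp only [below, mem_filter, mem_univ, true_and] at hf ⊢
        exact ⟨hf.1, (hi.trans he₁'.2.1.symm).trans hf.2.1, (hmax f hf).trans hl⟩
    rw [hset]
    exact he₁'.1
  have block_sum (o : Option (I × ℕ)) : ∑ e with block e = o, y e ∈ intReals := by
    cases o with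
    | none =>
      have htotal : ∑ e, y e ∈ intReals := by
        rw [← Finset.sum_fiberwise_of_maps_to (s := univ) (t := univ.image a) (g := a)
          (fun e _ => mem_image_of_mem a (mem_univ e)) y]
        exact sum_mem fun u _ => ha u
      have hrest : ∑ e with ¬ block e = none, y e ∈ intReals := by
        rw [← Finset.sum_fiberwise _ b]
        refine sum_mem fun i _ => ?_
        convert cumulative i 1 le_rfl using 2
        ext e
        simp [block, Nat.one_le_iff_ne_zero, and_comm]
      rw [eq_sub_of_add_eq (sum_filter_add_sum_filter_not univ (fun e => block e = none) y)]
      exact sub_mem htotal hrest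
    | some q =>
      obtain ⟨i, k⟩ := q
      obtain rfl | hk := Nat.eq_zero_or_pos k
      · rw [filter_false_of_mem, sum_empty]
        · exact zero_mem _
        · intro e _ he
          simp only [block] at he
          split_ifs at he with h
          simp only [Option.some.injEq, Prod.mk.injEq] at he
          exact h he.2
      · have hsplit : ∑ e with b e = i ∧ k ≤ level e, y e =
            ∑ e with block e = some (i, k), y e + ∑ e with b e = i ∧ k + 1 ≤ level e, y e := by
          rw [← sum_union]
          · congr 1
            ext e
            simp only [mem_filter, mem_univ, true_and, mem_union, block]
            split_ifs <;> grind
          · rw [disjoint_filter]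
            intro e _ he
            simp only [block] at he
            split_ifs at he
            grind
        rw [eq_sub_of_add_eq hsplit.symm]
        exact sub_mem (cumulative i k hk) (cumulative i (k + 1) (by omega))
  obtain ⟨d, hd0, hdy, hda, hdb⟩ :=
    exists_direction_of_fiber_sums_mem_intReals a block y ha block_sum hy
  refine ⟨d, hd0, hdy, hda, fun e' he' => ?_⟩
  have hself : e' ∈ below e' := by simp [below, he']
  have hset : (univ.filter fun e => b e = b e' ∧ w e' ≤ w e) =
      univ.filter fun e => b e = b e' ∧ level e' ≤ level e := by
    ext e
    simp only [mem_filter, mem_univ, true_and]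
    refine and_congr_right fun hi => ⟨fun h => card_le_card (below_mono hi h), fun h => ?_⟩
    by_contra! hlt
    refine h.not_gt (card_lt_card ⟨below_mono hi.symm hlt.le, fun hsub => ?_⟩)
    have := hsub hself
    simp only [below, mem_filter, mem_univ, true_and] at this
    exact hlt.not_ge this.2.2
  have hlevel : level e' ≠ 0 := (card_pos.2 ⟨e', hself⟩).ne'
  rw [upperSum, hset, ← Finset.sum_fiberwise_of_maps_to (t := univ.image block) (g := block)
    (fun e _ => mem_image_of_mem block (mem_univ e)) d]
  refine sum_eq_zero fun o _ => ?_
  rw [filter_filter]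
  by_cases ho : ∃ k, level e' ≤ k ∧ o = some (b e', k)
  · obtain ⟨k, hk, rfl⟩ := ho
    rw [← hdb (some (b e', k))]
    congr 1
    ext e
    simp only [mem_filter, mem_univ, true_and, block]
    split_ifs <;> grind
  · rw [filter_false_of_mem, sum_empty]
    rintro e - ⟨⟨h1, h2⟩, rfl⟩
    refine ho ⟨level e, h2, ?_⟩
    simp only [block]
    rw [if_neg (by omega), h1]

/-- The vectors in the unit cube that have the same fiber sums as `x` under `a`, and whose upper
sums lie between the floor and the ceiling of those of `x`. -/
def roundingPolytope {E U I : Type*} [Fintype E] [DecidableEq U] [DecidableEq I]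
    (a : E → U) (b : E → I) (w : E → ℝ) (x : E → ℝ) : Set (E → ℝ) :=
  {y | (∀ e, 0 ≤ y e ∧ y e ≤ 1) ∧ (∀ u, ∑ e with a e = u, y e = ∑ e with a e = u, x e) ∧
    ∀ e, ⌊upperSum b w x e⌋ ≤ upperSum b w y e ∧ upperSum b w y e ≤ ⌈upperSum b w x e⌉}

section

variable {E U I : Type*} [Fintype E] [DecidableEq U] [DecidableEq I]
  (a : E → U) (b : E → I) (w : E → ℝ) (x : E → ℝ)

theorem isCompact_roundingPolytope : IsCompact (roundingPolytope a b w x) := by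
  refine IsCompact.of_isClosed_subset (isCompact_Icc (a := (0 : E → ℝ)) (b := 1)) ?_
    fun y hy => ⟨fun e => (hy.1 e).1, fun e => (hy.1 e).2⟩
  simp only [roundingPolytope, upperSum, Set.ofPred_and, Set.ofPred_forall]
  refine IsClosed.inter ?_ (IsClosed.inter ?_ ?_)
  · exact isClosed_iInter fun e => (isClosed_le (by fun_prop) (by fun_prop)).inter
      (isClosed_le (by fun_prop) (by fun_prop))
  · exact isClosed_iInter fun u => isClosed_eq (by fun_prop) (by fun_prop)
  · exact isClosed_iInter fun e => (isClosed_le (by fun_prop) (by fun_prop)).inter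
      (isClosed_le (by fun_prop) (by fun_prop))

theorem convex_roundingPolytope : Convex ℝ (roundingPolytope a b w x) := by
  rintro y ⟨hy, hya, hyb⟩ z ⟨hz, hza, hzb⟩ s t hs ht hst
  have hsum (p : E → Prop) [DecidablePred p] : ∑ e with p e, (s • y + t • z) e =
      s * ∑ e with p e, y e + t * ∑ e with p e, z e := by
    simp [sum_add_distrib, mul_sum]
  refine ⟨fun e => ?_, fun u => ?_, fun e => ?_⟩
  · exact convex_Icc (0 : ℝ) 1 (hy e) (hz e) hs ht hst
  · rw [hsum, hya, hza, ← add_mul, hst, one_mul]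
  · have hupper : upperSum b w (s • y + t • z) e = s * upperSum b w y e + t * upperSum b w z e :=
      hsum _
    rw [hupper]
    exact convex_Icc (_ : ℝ) _ (hyb e) (hzb e) hs ht hst

variable {x}

theorem mem_roundingPolytope_self (hx : ∀ e, 0 ≤ x e ∧ x e ≤ 1) :
    x ∈ roundingPolytope a b w x :=
  ⟨hx, fun _ => rfl, fun _ => ⟨Int.floor_le _, Int.le_ceil _⟩⟩

theorem mem_intReals_of_mem_extremePoints [Fintype I]
    (ha : ∀ u, ∑ e with a e = u, x e ∈ intReals) {y : E → ℝ}
    (hy : y ∈ (roundingPolytope a b w x).extremePoints ℝ) (e : E) : y e ∈ intReals := by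
  by_contra he
  obtain ⟨⟨hy01, hya, hyb⟩, hext⟩ := hy
  obtain ⟨d, hd0, hdy, hda, hdb⟩ := exists_direction a b w y (fun u => hya u ▸ ha u) ⟨e, he⟩
  have hev : ∀ᶠ ε in nhds (0 : ℝ), y + ε • d ∈ roundingPolytope a b w x := by
    have h1 : ∀ᶠ ε in nhds (0 : ℝ), ∀ e, 0 ≤ y e + ε * d e ∧ y e + ε * d e ≤ 1 := by
      rw [Filter.eventually_all]
      intro e
      simpa using eventually_add_mul_mem_Icc (l := 0) (u := 1) (by simpa using (hy01 e).1)
        (by simpa using (hy01 e).2) (hdy e)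
    have h2 := Filter.eventually_all.2 fun e =>
      eventually_add_mul_mem_Icc (hyb e).1 (hyb e).2 (hdb e)
    filter_upwards [h1, h2] with ε hε1 hε2
    refine ⟨hε1, fun u => ?_, fun e => ?_⟩
    · simp [sum_add_distrib, ← mul_sum, hda, hya]
    · rw [upperSum_add_smul]
      exact hε2 e
  obtain ⟨δ, hδ, hball⟩ := Metric.eventually_nhds_iff.1 hev
  have hplus := hball (y := δ / 2) (by rw [Real.dist_eq, sub_zero, abs_of_pos] <;> linarith)
  have hminus := hball (y := -(δ / 2))
    (by rw [Real.dist_eq, sub_zero, abs_neg, abs_of_pos] <;> linarith)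
  have hseg : y ∈ openSegment ℝ (y + (δ / 2) • d) (y + (-(δ / 2)) • d) := by
    refine ⟨1 / 2, 1 / 2, by norm_num, by norm_num, by norm_num, ?_⟩
    ext e
    simp
    ring
  have heq := hext hplus hminus hseg
  rw [add_eq_left, smul_eq_zero] at heq
  exact heq.elim (half_pos hδ).ne' hd0

/-- A fractional vector in the unit cube with integral fiber sums is a convex combination of few
integral vectors in its rounding polytope. -/
theorem exists_convex_combination_integral [Fintype I] (hx : ∀ e, 0 ≤ x e ∧ x e ≤ 1)
    (ha : ∀ u, ∑ e with a e = u, x e ∈ intReals) :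
    ∃ (ℓ : ℕ) (y : Fin ℓ → E → ℝ) (p : Fin ℓ → ℝ), ℓ ≤ Fintype.card E + 1 ∧ (∀ k, 0 ≤ p k) ∧
      ∑ k, p k = 1 ∧ ∑ k, p k • y k = x ∧
      ∀ k, y k ∈ roundingPolytope a b w x ∧ ∀ e, y k e = 0 ∨ y k e = 1 := by
  have h01 {y : E → ℝ} (hy : y ∈ (roundingPolytope a b w x).extremePoints ℝ) (e : E) :
      y e = 0 ∨ y e = 1 :=
    eq_zero_or_one_of_mem_intReals (mem_intReals_of_mem_extremePoints a b w ha hy e)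
      (hy.1.1 e).1 (hy.1.1 e).2
  have hfin : ((roundingPolytope a b w x).extremePoints ℝ).Finite := by
    refine (Set.Finite.pi' fun _ : E => Set.toFinite ({0, 1} : Set ℝ)).subset ?_
    intro y hy e
    simpa using h01 hy e
  have hmem : x ∈ convexHull ℝ ((roundingPolytope a b w x).extremePoints ℝ) := by
    rw [← (hfin.isClosed_convexHull ℝ).closure_eq, closure_convexHull_extremePoints
      (isCompact_roundingPolytope a b w x) (convex_roundingPolytope a b w x)]
    exact mem_roundingPolytope_self a b w hx
  obtain ⟨κ, hκ, z, p, hz, haff, hp, hp1, hpz⟩ := eq_pos_convex_span_of_mem_convexHull hmem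
  have hcard : Fintype.card κ ≤ Fintype.card E + 1 := by
    refine haff.card_le_finrank_succ.trans ?_
    have := Submodule.finrank_le (vectorSpan ℝ (Set.range z))
    rw [Module.finrank_fintype_fun_eq_card] at this
    omega
  let σ := (Fintype.equivFin κ).symm
  refine ⟨Fintype.card κ, z ∘ σ, p ∘ σ, hcard, fun k => (hp _).le, ?_, ?_, fun k => ?_⟩
  · rw [← hp1]; exact σ.sum_comp p
  · rw [← hpz]; exact σ.sum_comp fun k => p k • z k
  · have := hz (Set.mem_range_self (σ k))
    exact ⟨this.1, h01 this⟩

theorem abs_sum_mul_sub_le_of_mem_roundingPolytope {y y' : E → ℝ}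
    (hy : y ∈ roundingPolytope a b w x) (hy' : y' ∈ roundingPolytope a b w x) (i : I) {M : ℝ}
    (hM0 : 0 ≤ M) (hw : ∀ e, 0 ≤ w e) (hM : ∀ e, b e = i → w e ≤ M) :
    |∑ e with b e = i, w e * (y e - y' e)| ≤ M := by
  classical
  have h := abs_sum_sub_mul_le (univ.filter fun e => b e = i) w (fun e => y e - y' e) M
    (by simpa using hM) 0 hM0 (fun e _ => hw e) (by
      intro e' he' _
      obtain rfl : b e' = i := by simpa using he'
      rw [filter_filter, sum_sub_distrib]
      change |upperSum b w y e' - upperSum b w y' e'| ≤ 1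
      have h1 := hy.2.2 e'
      have h2 := hy'.2.2 e'
      have h3 : (⌈upperSum b w x e'⌉ : ℝ) ≤ ⌊upperSum b w x e'⌋ + 1 := by
        exact_mod_cast Int.ceil_le_floor_add_one _
      rw [abs_le]
      constructor <;> linarith)
  simpa using h

end

/-- faithful implementation lemma: every fractional allocation `x`
with `f` strictly fractional entries can be implemented by a distribution over at
most `f+1` allocations, with small spread: for each agent, the values received in
any two allocations of the support differ by at most the maximal value of an item
that `x` allocates to her fractionally (taken as `0` if there is none). -/
theorem stmt12 {ι : Type*} [Fintype ι] [DecidableEq ι] (n : ℕ) (hn : 1 ≤ n)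
    (v : Fin n → ι → ℝ) (hv : ∀ i j, 0 ≤ v i j)
    (x : Fin n → ι → ℝ)
    (hx01 : ∀ i j, 0 ≤ x i j ∧ x i j ≤ 1)
    (hx1 : ∀ j, ∑ i, x i j = 1)
    (f : ℕ)
    (hf : f = (Finset.univ.filter
      (fun q : Fin n × ι => 0 < x q.1 q.2 ∧ x q.1 q.2 < 1)).card) :
    ∃ (ℓ : ℕ) (A : Fin ℓ → Fin n → Finset ι) (p : Fin ℓ → ℝ),
      ℓ ≤ f + 1 ∧
      (∀ k, 0 ≤ p k) ∧ (∑ k, p k = 1) ∧ (∀ k, isAlloc (A k)) ∧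
      (∀ i j, (∑ k, p k * (if j ∈ A k i then (1 : ℝ) else 0)) = x i j) ∧
      (∀ (i : Fin n) (k k' : Fin ℓ),
        |val (v i) (A k i) - val (v i) (A k' i)| ≤
          (Finset.univ.filter (fun j => 0 < x i j ∧ x i j < 1)).fold max 0 (v i)) := by
  classical
  let frac (q : Fin n × ι) : Prop := 0 < x q.1 q.2 ∧ x q.1 q.2 < 1
  let E := {q : Fin n × ι // frac q}
  have hcardE : Fintype.card E = f := by rw [hf, Fintype.card_subtype]
  have hint (i : Fin n) (j : ι) (h : ¬ frac (i, j)) : x i j = 0 ∨ x i j = 1 := by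
    by_contra! hne
    exact h ⟨lt_of_le_of_ne (hx01 i j).1 hne.1.symm, lt_of_le_of_ne (hx01 i j).2 hne.2⟩
  let glue (y : E → ℝ) (i : Fin n) (j : ι) : ℝ := if h : frac (i, j) then y ⟨(i, j), h⟩ else x i j
  have sum_item (y : E → ℝ) (j : ι) : ∑ i, glue y i j =
      ∑ e : E with e.1.2 = j, y e + ∑ i with ¬ frac (i, j), x i j := by
    rw [← sum_filter_add_sum_filter_not univ (fun i => frac (i, j))]
    congr 1
    · symm
      refine sum_bij' (fun e _ => e.1.1)
        (fun i hi => (⟨(i, j), (mem_filter.1 hi).2⟩ : E)) ?_ ?_ ?_ ?_ ?_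
      · rintro ⟨⟨i, j'⟩, he⟩ h
        obtain rfl : j' = j := by simpa using h
        simpa using he
      · simp
      · rintro ⟨⟨i, j'⟩, he⟩ h
        obtain rfl : j' = j := by simpa using h
        rfl
      · simp
      · rintro ⟨⟨i, j'⟩, he⟩ h
        obtain rfl : j' = j := by simpa using h
        simp [glue, he]
    · refine sum_congr rfl fun i hi => ?_
      simp [glue, (mem_filter.1 hi).2]
  let X (e : E) : ℝ := x e.1.1 e.1.2
  have glue_X (i : Fin n) (j : ι) : glue X i j = x i j := by simp [glue, X]
  have hXcol (j : ι) : ∑ e : E with e.1.2 = j, X e ∈ intReals := by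
    have h := sum_item X j
    simp only [glue_X, hx1] at h
    rw [eq_sub_of_add_eq h.symm]
    refine sub_mem one_mem_intReals (sum_mem fun i hi => ?_)
    obtain h | h := hint i j (mem_filter.1 hi).2
    · rw [h]; exact zero_mem _
    · rw [h]; exact one_mem_intReals
  obtain ⟨ℓ, y, p, hℓ, hp, hp1, hpy, hy⟩ := exists_convex_combination_integral
    (fun e : E => e.1.2) (fun e : E => e.1.1) (fun e : E => v e.1.1 e.1.2)
    (x := X) (fun e => hx01 _ _) hXcol
  have glue01 (k : Fin ℓ) (i : Fin n) (j : ι) : glue (y k) i j = 0 ∨ glue (y k) i j = 1 := by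
    by_cases h : frac (i, j)
    · simpa [glue, h] using (hy k).2 ⟨(i, j), h⟩
    · simpa [glue, h] using hint i j h
  have glue_sum (k : Fin ℓ) (j : ι) : ∑ i, glue (y k) i j = 1 := by
    rw [sum_item, (hy k).1.2.1 j, ← sum_item]
    simp only [glue_X, hx1]
  let A (k : Fin ℓ) (i : Fin n) : Finset ι := {j | glue (y k) i j = 1}
  have indicator_A (k : Fin ℓ) (i : Fin n) (j : ι) :
      (if j ∈ A k i then (1 : ℝ) else 0) = glue (y k) i j := by
    obtain h | h := glue01 k i j <;> simp [A, h]
  have val_A (k : Fin ℓ) (i : Fin n) : val (v i) (A k i) = ∑ j, v i j * glue (y k) i j := by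
    simp only [← indicator_A, mul_ite, mul_one, mul_zero, sum_ite_mem, univ_inter]
    rfl
  refine ⟨ℓ, A, p, hcardE ▸ hℓ, hp, hp1, fun k => ⟨fun i i' hne => ?_, ?_⟩, fun i j => ?_,
    fun i k k' => ?_⟩
  · rw [disjoint_left]
    intro j hj hj'
    simp only [A, mem_filter, mem_univ, true_and] at hj hj'
    have hle : ∑ t ∈ {i, i'}, glue (y k) t j ≤ ∑ t, glue (y k) t j :=
      sum_le_sum_of_subset_of_nonneg (subset_univ _) fun t _ _ => by
        obtain h | h := glue01 k t j <;> simp [h]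
    rw [sum_pair hne, hj, hj', glue_sum] at hle
    norm_num at hle
  · rw [eq_univ_iff_forall]
    intro j
    by_contra hj
    have hzero : ∑ i, glue (y k) i j = 0 := sum_eq_zero fun i _ => by
      refine (glue01 k i j).resolve_right fun h => hj ?_
      simp only [mem_biUnion, mem_univ, true_and]
      exact ⟨i, by simp [A, h]⟩
    rw [glue_sum] at hzero
    exact one_ne_zero hzero
  · simp only [indicator_A]
    by_cases h : frac (i, j)
    · have := congrFun hpy ⟨(i, j), h⟩
      simpa [glue, h, X] using this
    · simp [glue, h, ← sum_mul, hp1]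
  · have hM0 : 0 ≤ (univ.filter fun j => 0 < x i j ∧ x i j < 1).fold max 0 (v i) :=
      (le_fold_max _).2 (Or.inl le_rfl)
    have hspread := abs_sum_mul_sub_le_of_mem_roundingPolytope (x := X) _ _ _ (hy k).1 (hy k').1 i
      hM0 (fun e => hv _ _) (by
        rintro ⟨⟨i, j⟩, he⟩ rfl
        exact (le_fold_max _).2 (Or.inr ⟨j, by simpa using he, le_rfl⟩))
    convert hspread using 2
    rw [val_A, val_A, ← sum_sub_distrib]
    simp only [← mul_sub]
    rw [← sum_filter_add_sum_filter_not univ (fun j => frac (i, j)),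
      sum_eq_zero (s := univ.filter fun j => ¬ frac (i, j)), add_zero]
    · symm
      refine sum_bij' (fun e _ => e.1.2)
        (fun j hj => (⟨(i, j), (mem_filter.1 hj).2⟩ : E)) ?_ ?_ ?_ ?_ ?_
      · rintro ⟨⟨i', j⟩, he⟩ h
        obtain rfl : i' = i := by simpa using h
        simpa using he
      · simp
      · rintro ⟨⟨i', j⟩, he⟩ h
        obtain rfl : i' = i := by simpa using h
        rfl
      · simp
      · rintro ⟨⟨i', j⟩, he⟩ h
        obtain rfl : i' = i := by simpa using h
        simp [glue, he]
    · intro j hj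
      simp [glue, (mem_filter.1 hj).2]
end
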